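/- Let R be a commutative Noetherian ring of finite Krull dimension. If the class of GP-pure injective R-modules coincides with the class of Gorenstein injective R-modules, then R is virtually Gorenstein, i.e. GP^⊥ = ^⊥GI. -/

import Mathlib

open CategoryTheory Opposite Limits MonoidalCategory

universe u

variable {R : Type u} [CommRing R]

/-- `Q` is a Gorenstein projective module: it is the cokernel `Coker (P₁ → P₀)` of a totally
acyclic complex of projective modules, i.e. an exact complex of projectives which stays exact
under `Hom(-, P)` for every projective `P`. -/
def IsGorensteinProjective (Q : ModuleCat.{u} R) : Prop :=
  ∃ C : ChainComplex (ModuleCat.{u} R) ℤ,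
    (∀ i, Projective (C.X i)) ∧
    (∀ i, C.ExactAt i) ∧
    Nonempty (Q ≅ cokernel (C.d 1 0)) ∧
    ∀ P : ModuleCat.{u} R, Projective P →
      ∀ (i : ℤ) (f : C.X i ⟶ P), C.d (i + 1) i ≫ f = 0 →
        ∃ g : C.X (i - 1) ⟶ P, f = C.d i (i - 1) ≫ g

/-- `E` is a Gorenstein injective module: it is the kernel `Ker (I⁰ → I¹)` of a totally acyclic
complex of injective modules, i.e. an exact complex of injectives which stays exact under
`Hom(I, -)` for every injective `I`. -/
def IsGorensteinInjective (E : ModuleCat.{u} R) : Prop :=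
  ∃ C : CochainComplex (ModuleCat.{u} R) ℤ,
    (∀ i, Injective (C.X i)) ∧
    (∀ i, C.ExactAt i) ∧
    Nonempty (E ≅ kernel (C.d 0 1)) ∧
    ∀ I : ModuleCat.{u} R, Injective I →
      ∀ (i : ℤ) (f : I ⟶ C.X i), f ≫ C.d i (i + 1) = 0 →
        ∃ g : I ⟶ C.X (i - 1), f = g ≫ C.d (i - 1) i

/-- `M` is a Gorenstein flat module: it is a cokernel in an exact complex of flat modules which
remains exact after tensoring with any injective module. -/
def IsGorensteinFlat (M : ModuleCat.{u} R) : Prop :=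
  ∃ C : ChainComplex (ModuleCat.{u} R) ℤ,
    (∀ i, Module.Flat R (C.X i)) ∧
    (∀ i, C.ExactAt i) ∧
    Nonempty (M ≅ cokernel (C.d 1 0)) ∧
    ∀ I : ModuleCat.{u} R, Injective I → ∀ i : ℤ,
      (((tensorLeft I).mapHomologicalComplex (ComplexShape.down ℤ)).obj C).ExactAt i

/-- A short exact sequence `0 → X₁ → X₂ → X₃ → 0` is `𝒳`-pure exact if
`Hom(U, X₂) → Hom(U, X₃)` is surjective for every `U ∈ 𝒳`. -/
def XPureExact (𝒳 : ModuleCat.{u} R → Prop) (S : ShortComplex (ModuleCat.{u} R)) : Prop :=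
  ∀ U : ModuleCat.{u} R, 𝒳 U → ∀ φ : U ⟶ S.X₃, ∃ ψ : U ⟶ S.X₂, ψ ≫ S.g = φ

/-- A short exact sequence `0 → X₁ → X₂ → X₃ → 0` is `𝒳`-copure exact if
`Hom(X₂, V) → Hom(X₁, V)` is surjective for every `V ∈ 𝒳`. -/
def XCopureExact (𝒳 : ModuleCat.{u} R → Prop) (S : ShortComplex (ModuleCat.{u} R)) : Prop :=
  ∀ V : ModuleCat.{u} R, 𝒳 V → ∀ φ : S.X₁ ⟶ V, ∃ ψ : S.X₂ ⟶ V, S.f ≫ ψ = φ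

/-- `M` is `𝒳`-pure flat: `M ⊗ -` leaves every `𝒳`-pure exact short exact sequence exact. -/
def XPureFlat (𝒳 : ModuleCat.{u} R → Prop) (M : ModuleCat.{u} R) : Prop :=
  ∀ S : ShortComplex (ModuleCat.{u} R), S.ShortExact → XPureExact 𝒳 S →
    Function.Injective ((tensorLeft M).map S.f)

/-- `N` is `𝒳`-pure injective: `Hom(-, N)` leaves every `𝒳`-pure exact short exact
sequence exact. -/
def XPureInjective (𝒳 : ModuleCat.{u} R → Prop) (N : ModuleCat.{u} R) : Prop :=
  ∀ S : ShortComplex (ModuleCat.{u} R), S.ShortExact → XPureExact 𝒳 S →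
    ∀ φ : S.X₁ ⟶ N, ∃ ψ : S.X₂ ⟶ N, S.f ≫ ψ = φ

/-- `M` is `𝒳`-pure projective: `Hom(M, -)` leaves every `𝒳`-pure exact short exact
sequence exact. -/
def XPureProjective (𝒳 : ModuleCat.{u} R → Prop) (M : ModuleCat.{u} R) : Prop :=
  ∀ S : ShortComplex (ModuleCat.{u} R), S.ShortExact → XPureExact 𝒳 S →
    ∀ φ : M ⟶ S.X₃, ∃ ψ : M ⟶ S.X₂, ψ ≫ S.g = φ

/-- `GP`-pure exactness: `Hom(Q, -)` leaves the sequence exact for all Gorenstein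
projective `Q`. -/
abbrev GPPureExact (S : ShortComplex (ModuleCat.{u} R)) : Prop :=
  XPureExact IsGorensteinProjective S

/-- `GI`-copure exactness: `Hom(-, E)` leaves the sequence exact for all Gorenstein
injective `E`. -/
abbrev GICopureExact (S : ShortComplex (ModuleCat.{u} R)) : Prop :=
  XCopureExact IsGorensteinInjective S

abbrev GPPureProjective (M : ModuleCat.{u} R) : Prop :=
  XPureProjective IsGorensteinProjective M

abbrev GPPureInjective (M : ModuleCat.{u} R) : Prop :=
  XPureInjective IsGorensteinProjective M

abbrev GPPureFlat (M : ModuleCat.{u} R) : Prop :=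
  XPureFlat IsGorensteinProjective M

/-- `Ext^n_R(M, N)` vanishes. -/
abbrev extVanish (n : ℕ) (M N : ModuleCat.{u} R) : Prop :=
  Subsingleton (((Ext R (ModuleCat.{u} R) n).obj (op M)).obj N)

/-- `M` belongs to `GP^⊥`. -/
abbrev MemGPperp (M : ModuleCat.{u} R) : Prop :=
  ∀ Q : ModuleCat.{u} R, IsGorensteinProjective Q → extVanish 1 Q M

/-- `M` belongs to `^⊥GI`. -/
abbrev MemPerpGI (M : ModuleCat.{u} R) : Prop :=
  ∀ E : ModuleCat.{u} R, IsGorensteinInjective E → extVanish 1 M E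

/-- Gorenstein projective dimension of `M` is at most `n`: there is a resolution
`0 → G_n → ⋯ → G_0 → M → 0` by Gorenstein projective modules. -/
def GpdLE : ℕ → ModuleCat.{u} R → Prop
  | 0, M => IsGorensteinProjective M
  | n + 1, M =>
    ∃ S : ShortComplex (ModuleCat.{u} R), S.ShortExact ∧ Nonempty (S.X₃ ≅ M) ∧
      IsGorensteinProjective S.X₂ ∧ GpdLE n S.X₁

/-- Gorenstein injective dimension of `M` is at most `n`: there is a coresolution
`0 → M → E⁰ → ⋯ → Eⁿ → 0` by Gorenstein injective modules. -/
def GidLE : ℕ → ModuleCat.{u} R → Prop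
  | 0, M => IsGorensteinInjective M
  | n + 1, M =>
    ∃ S : ShortComplex (ModuleCat.{u} R), S.ShortExact ∧ Nonempty (S.X₁ ≅ M) ∧
      IsGorensteinInjective S.X₂ ∧ GidLE n S.X₃

/-- Gorenstein flat dimension of `M` is at most `n`. -/
def GfdLE : ℕ → ModuleCat.{u} R → Prop
  | 0, M => IsGorensteinFlat M
  | n + 1, M =>
    ∃ S : ShortComplex (ModuleCat.{u} R), S.ShortExact ∧ Nonempty (S.X₃ ≅ M) ∧
      IsGorensteinFlat S.X₂ ∧ GfdLE n S.X₁

/-- The Pontryagin dual `M⁺ = Hom_ℤ(M, ℚ/ℤ)` as an `R`-module. -/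
noncomputable def characterDual (M : ModuleCat.{u} R) : ModuleCat.{u} R :=
  ModuleCat.of R (CharacterModule M)

/-- `R` is a coherent ring: every finitely generated ideal is finitely presented. -/
def IsCoherentRing (R : Type u) [CommRing R] : Prop :=
  ∀ I : Ideal R, I.FG → Module.FinitePresentation R I

/-- `φ : G → M` is a Gorenstein projective precover. -/
def IsGPPrecover {G M : ModuleCat.{u} R} (φ : G ⟶ M) : Prop :=
  IsGorensteinProjective G ∧
    ∀ G' : ModuleCat.{u} R, IsGorensteinProjective G' →
      ∀ ψ : G' ⟶ M, ∃ χ : G' ⟶ G, χ ≫ φ = ψ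

/-- The short exact sequence `0 → Im d_{i+1} → X_i → Im d_i → 0` extracted from a complex. -/
noncomputable def imagesShortComplex (C : ChainComplex (ModuleCat.{u} R) ℤ) (i : ℤ) :
    ShortComplex (ModuleCat.{u} R) :=
  ShortComplex.mk (image.ι (C.d (i + 1) i)) (factorThruImage (C.d i (i - 1)))
    (by
      rw [← cancel_epi (factorThruImage (C.d (i + 1) i)),
        ← cancel_mono (image.ι (C.d i (i - 1)))]
      simp)

namespace VirtuallyGorenstein

section PureExact

variable {P Y : ℕ → Type u} [∀ n, AddCommGroup (P n)] [∀ n, Module R (P n)]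
  [∀ n, AddCommGroup (Y n)] [∀ n, Module R (Y n)]

/-- A sequence of linear maps such that `Hom_R(N, -)` makes it exact at every positive spot, for
every finitely generated module `N`. -/
def PureExact (dY : ∀ n, Y n →ₗ[R] Y (n + 1)) : Prop :=
  ∀ (n : ℕ) (N : Type u) [AddCommGroup N] [Module R N] [Module.Finite R N]
    (φ : N →ₗ[R] Y (n + 1)), dY (n + 1) ∘ₗ φ = 0 → ∃ ψ : N →ₗ[R] Y n, dY n ∘ₗ ψ = φ

variable {dP : ∀ n, P n →ₗ[R] P (n + 1)} {dY : ∀ n, Y n →ₗ[R] Y (n + 1)}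

/-- Pure exactness also lifts maps vanishing on a submodule to maps vanishing on it. -/
lemma PureExact.exists_lift_vanishing (hY : PureExact dY) {M L : Type u} [AddCommGroup M]
    [Module R M] [Module.Finite R M] [AddCommGroup L] [Module R L] (j : L →ₗ[R] M) {n : ℕ}
    (φ : M →ₗ[R] Y (n + 1)) (hj : φ ∘ₗ j = 0) (hφ : dY (n + 1) ∘ₗ φ = 0) :
    ∃ ψ : M →ₗ[R] Y n, dY n ∘ₗ ψ = φ ∧ ψ ∘ₗ j = 0 := by
  obtain ⟨ψ, hψ⟩ := hY n (M ⧸ LinearMap.range j)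
    ((LinearMap.range j).liftQ φ (by
      rw [LinearMap.range_le_ker_iff]; exact hj))
    (by
      ext x
      exact LinearMap.congr_fun hφ x)
  refine ⟨ψ ∘ₗ (LinearMap.range j).mkQ, ?_, ?_⟩
  · rw [← LinearMap.comp_assoc, hψ, Submodule.liftQ_mkQ]
  · rw [LinearMap.comp_assoc, LinearMap.range_mkQ_comp, LinearMap.comp_zero]

/-- A chain map from a degreewise finitely generated complex to a pure exact complex is
null-homotopic. -/
lemma PureExact.exists_homotopy_of_finite [∀ n, Module.Finite R (P n)] (hY : PureExact dY)
    (hdP : ∀ n, dP (n + 1) ∘ₗ dP n = 0) (hdY : ∀ n, dY (n + 1) ∘ₗ dY n = 0)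
    [Subsingleton (Y 0)] (F : ∀ n, P n →ₗ[R] Y n)
    (hF : ∀ n, F (n + 1) ∘ₗ dP n = dY n ∘ₗ F n) :
    ∃ s : ∀ n, P (n + 1) →ₗ[R] Y n,
      ∀ n, F (n + 1) = s (n + 1) ∘ₗ dP (n + 1) + dY n ∘ₗ s n := by
  have step (n : ℕ) (s : {s : P (n + 1) →ₗ[R] Y n // (F (n + 1) - dY n ∘ₗ s) ∘ₗ dP n = 0}) :
      ∃ (s' : {s : P (n + 1 + 1) →ₗ[R] Y (n + 1) //
          (F (n + 1 + 1) - dY (n + 1) ∘ₗ s) ∘ₗ dP (n + 1) = 0}) (t : P (n + 1) →ₗ[R] Y n),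
        t ∘ₗ dP n = s.1 ∘ₗ dP n ∧ F (n + 1) = s'.1 ∘ₗ dP (n + 1) + dY n ∘ₗ t := by
    obtain ⟨s, hs⟩ := s
    obtain ⟨μ, hμ, hμ'⟩ := hY.exists_lift_vanishing (dP (n + 1)) (dY (n + 2) ∘ₗ F (n + 2))
      (by rw [LinearMap.comp_assoc, hF, ← LinearMap.comp_assoc, hdY, LinearMap.zero_comp])
      (by rw [← LinearMap.comp_assoc, hdY, LinearMap.zero_comp])
    obtain ⟨s', hs'⟩ := hY (n + 1) _ (F (n + 2) - μ)
      (by rw [LinearMap.comp_sub, hμ, sub_self])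
    obtain ⟨t, ht, ht'⟩ := hY.exists_lift_vanishing (dP n)
      (F (n + 1) - dY n ∘ₗ s - s' ∘ₗ dP (n + 1))
      (by rw [LinearMap.sub_comp, hs, LinearMap.comp_assoc, hdP, LinearMap.comp_zero, sub_zero])
      (by
        rw [LinearMap.comp_sub, LinearMap.comp_sub, ← LinearMap.comp_assoc, hdY,
          ← LinearMap.comp_assoc, hs', LinearMap.sub_comp, hμ', ← hF, LinearMap.zero_comp]
        abel)
    refine ⟨⟨s', ?_⟩, s + t, ?_, ?_⟩
    · rw [hs', sub_sub_cancel, hμ']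
    · rw [LinearMap.add_comp, ht', add_zero]
    · rw [LinearMap.comp_add, ht]
      abel
  choose g t ht ht' using step
  let σ : ∀ n, {s : P (n + 1) →ₗ[R] Y n // (F (n + 1) - dY n ∘ₗ s) ∘ₗ dP n = 0} :=
    fun n ↦ Nat.rec ⟨0, by
      rw [LinearMap.comp_zero, sub_zero, hF]
      have : F 0 = 0 := LinearMap.ext fun x ↦ Subsingleton.elim _ _
      rw [this, LinearMap.comp_zero]⟩ g n
  refine ⟨fun n ↦ t n (σ n), fun n ↦ ?_⟩
  rw [ht, ht' n (σ n)]

end PureExact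
section Homotopy

variable {Y : ℕ → Type u} [∀ n, AddCommGroup (Y n)] [∀ n, Module R (Y n)]
  {dY : ∀ n, Y n →ₗ[R] Y (n + 1)}

/-- The smallest family of subsets of the bases that contains a given one and is stable under the
differential. -/
def dClosure {B : ℕ → Type u} (d : ∀ n, (B n →₀ R) →ₗ[R] (B (n + 1) →₀ R))
    (A : ∀ n, Set (B n)) : ∀ n, Set (B n)
  | 0 => A 0
  | n + 1 => A (n + 1) ∪ ⋃ b ∈ dClosure d A n, ↑(d n (Finsupp.single b 1)).support

lemma subset_dClosure {B : ℕ → Type u} (d : ∀ n, (B n →₀ R) →ₗ[R] (B (n + 1) →₀ R))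
    (A : ∀ n, Set (B n)) (n : ℕ) : A n ⊆ dClosure d A n := by
  cases n with
  | zero => exact subset_rfl
  | succ n => exact Set.subset_union_left

lemma finite_dClosure {B : ℕ → Type u} (d : ∀ n, (B n →₀ R) →ₗ[R] (B (n + 1) →₀ R))
    {A : ∀ n, Set (B n)} (hA : ∀ n, (A n).Finite) (n : ℕ) : (dClosure d A n).Finite := by
  induction n with
  | zero => exact hA 0
  | succ n ih => exact (hA _).union (ih.biUnion fun b _ ↦ Finset.finite_toSet _)

lemma map_mem_supported_dClosure {B : ℕ → Type u} (d : ∀ n, (B n →₀ R) →ₗ[R] (B (n + 1) →₀ R))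
    (A : ∀ n, Set (B n)) (n : ℕ) :
    Finsupp.supported R R (dClosure d A n) ≤
      (Finsupp.supported R R (dClosure d A (n + 1))).comap (d n) := by
  rw [Finsupp.supported_eq_span_single, Submodule.span_le]
  rintro _ ⟨b, hb, rfl⟩
  rw [SetLike.mem_coe, Submodule.mem_comap, Finsupp.mem_supported]
  exact (Set.subset_biUnion_of_mem (u := fun b ↦ ((d n (Finsupp.single b 1)).support : Set (B (n + 1))))
    hb).trans Set.subset_union_right

/-- A null-homotopy of a chain map out of a complex of free modules, defined on a subcomplex
spanned by basis elements. -/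
structure PartialHomotopy {B : ℕ → Type u} (d : ∀ n, (B n →₀ R) →ₗ[R] (B (n + 1) →₀ R))
    (dY : ∀ n, Y n →ₗ[R] Y (n + 1)) (F : ∀ n, (B n →₀ R) →ₗ[R] Y n) where
  /-- the basis elements spanning the subcomplex -/
  carrier : ∀ n, Set (B n)
  /-- the homotopy, of which only the restriction to the subcomplex matters -/
  map : ∀ n, (B (n + 1) →₀ R) →ₗ[R] Y n
  closed : ∀ n, Finsupp.supported R R (carrier n) ≤
    (Finsupp.supported R R (carrier (n + 1))).comap (d n)
  eq : ∀ n, ∀ x ∈ Finsupp.supported R R (carrier (n + 1)),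
    F (n + 1) x = map (n + 1) (d (n + 1) x) + dY n (map n x)

namespace PartialHomotopy

variable {B : ℕ → Type u} {d : ∀ n, (B n →₀ R) →ₗ[R] (B (n + 1) →₀ R)}
  {F : ∀ n, (B n →₀ R) →ₗ[R] Y n}

/-- One partial homotopy extends another. -/
def Extends (p q : PartialHomotopy d dY F) : Prop :=
  (∀ n, p.carrier n ⊆ q.carrier n) ∧
    ∀ n, ∀ x ∈ Finsupp.supported R R (p.carrier (n + 1)), p.map n x = q.map n x

lemma Extends.trans {p q r : PartialHomotopy d dY F} (h : p.Extends q) (h' : q.Extends r) :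
    p.Extends r :=
  ⟨fun n ↦ (h.1 n).trans (h'.1 n), fun n x hx ↦
    (h.2 n x hx).trans (h'.2 n x (Finsupp.supported_mono (h.1 _) hx))⟩

lemma exists_upperBound (c : Set (PartialHomotopy d dY F)) (hc : IsChain Extends c) :
    ∃ ub, ∀ p ∈ c, Extends p ub := by
  classical
  let s (n : ℕ) : (B (n + 1) →₀ R) →ₗ[R] Y n := Finsupp.linearCombination R fun b ↦
    if h : ∃ p ∈ c, b ∈ p.carrier (n + 1) then h.choose.map n (Finsupp.single b 1) else 0
  have hs (p) (hp : p ∈ c) (n : ℕ) (x) (hx : x ∈ Finsupp.supported R R (p.carrier (n + 1))) :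
      p.map n x = s n x := by
    have hle : Finsupp.supported R R (p.carrier (n + 1)) ≤ LinearMap.eqLocus (p.map n) (s n) := by
      rw [Finsupp.supported_eq_span_single, Submodule.span_le]
      rintro _ ⟨b, hb, rfl⟩
      have h : ∃ p ∈ c, b ∈ p.carrier (n + 1) := ⟨p, hp, hb⟩
      have key : p.map n (Finsupp.single b 1) = h.choose.map n (Finsupp.single b 1) := by
        rcases eq_or_ne p h.choose with e | e
        · rw [← e]
        · rcases hc hp h.choose_spec.1 e with e | e
          · exact e.2 n _ (Finsupp.single_mem_supported (M := R) R (1 : R) hb)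
          · exact (e.2 n _ (Finsupp.single_mem_supported (M := R) R (1 : R) h.choose_spec.2)).symm
      simp only [SetLike.mem_coe, LinearMap.mem_eqLocus, s, Finsupp.linearCombination_single,
        one_smul]
      rw [dif_pos h, key]
    exact hle hx
  have hsub (p) (hp : p ∈ c) (n : ℕ) : p.carrier n ⊆ ⋃ q ∈ c, q.carrier n :=
    Set.subset_biUnion_of_mem (u := fun q : PartialHomotopy d dY F ↦ q.carrier n) hp
  refine ⟨⟨fun n ↦ ⋃ p ∈ c, p.carrier n, s, fun n ↦ ?_, fun n ↦ ?_⟩,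
    fun p hp ↦ ⟨hsub p hp, hs p hp⟩⟩
  · rw [Finsupp.supported_eq_span_single, Submodule.span_le]
    rintro _ ⟨b, hb, rfl⟩
    obtain ⟨p, hp, hb⟩ := Set.mem_iUnion₂.mp hb
    exact Finsupp.supported_mono (M := R) (R := R) (hsub p hp _) (p.closed n (Finsupp.single_mem_supported (M := R) R (1 : R) hb))
  · change Finsupp.supported R R (⋃ p ∈ c, p.carrier (n + 1)) ≤ LinearMap.eqLocus (F (n + 1))
      (s (n + 1) ∘ₗ d (n + 1) + dY n ∘ₗ s n)
    rw [Finsupp.supported_eq_span_single, Submodule.span_le]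
    rintro _ ⟨b, hb, rfl⟩
    obtain ⟨p, hp, hb⟩ := Set.mem_iUnion₂.mp hb
    have hb := Finsupp.single_mem_supported (M := R) R (1 : R) hb
    change F (n + 1) _ = s (n + 1) _ + dY n (s n _)
    rw [← hs p hp _ _ hb, ← hs p hp _ _ (p.closed _ hb), p.eq n _ hb]

open Classical in
lemma exists_extends_of_finite (hY : PureExact dY)
    (hd : ∀ n, d (n + 1) ∘ₗ d n = 0) (hdY : ∀ n, dY (n + 1) ∘ₗ dY n = 0)
    [Subsingleton (Y 0)] (hF : ∀ n, F (n + 1) ∘ₗ d n = dY n ∘ₗ F n)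
    (p : PartialHomotopy d dY F) (T : ∀ n, Set (B n)) (hT : ∀ n, (T n).Finite)
    (hTd : ∀ n, Finsupp.supported R R (T n) ≤ (Finsupp.supported R R (T (n + 1))).comap (d n)) :
    ∃ q, p.Extends q ∧ ∀ n, T n ⊆ q.carrier n := by
  let U (n : ℕ) : Set (B n) := T n \ p.carrier n
  let ρ (n : ℕ) : (B n →₀ R) →ₗ[R] Finsupp.supported R R (U n) := Finsupp.restrictDom R R (U n)
  have hρ (n : ℕ) (x) (hx : x ∈ Finsupp.supported R R (p.carrier n)) : ρ n x = 0 := by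
    ext b
    simp only [ρ, Finsupp.restrictDom_apply, Finsupp.filter_apply, ZeroMemClass.coe_zero,
      Finsupp.coe_zero, Pi.zero_apply, ite_eq_right_iff]
    intro hb
    by_contra h
    exact hb.2 (hx (Finsupp.mem_support_iff.mpr h))
  have hρ' (n : ℕ) (x) (hx : x ∈ Finsupp.supported R R (p.carrier n ∪ T n)) :
      x - ρ n x ∈ Finsupp.supported R R (p.carrier n) := by
    intro b hb
    by_contra h
    have hx' : x b ≠ 0 → b ∈ U n := fun hxb ↦
      ⟨(hx (Finsupp.mem_support_iff.mpr hxb)).resolve_left h, h⟩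
    apply Finsupp.mem_support_iff.mp hb
    simp only [ρ, Finsupp.restrictDom_apply, Finsupp.coe_sub, Pi.sub_apply, Finsupp.filter_apply]
    split_ifs with hU
    · simp
    · rw [sub_zero]; by_contra hxb; exact hU (hx' hxb)
  have hST (n : ℕ) : Finsupp.supported R R (p.carrier n ∪ T n) ≤
      (Finsupp.supported R R (p.carrier (n + 1) ∪ T (n + 1))).comap (d n) := by
    rw [Finsupp.supported_union, Finsupp.supported_union]
    exact sup_le ((p.closed n).trans (Submodule.comap_mono le_sup_left))
      ((hTd n).trans (Submodule.comap_mono le_sup_right))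
  have hU (n : ℕ) (x : Finsupp.supported R R (U n)) :
      (x : B n →₀ R) ∈ Finsupp.supported R R (p.carrier n ∪ T n) :=
    Finsupp.supported_mono (Set.sdiff_subset.trans Set.subset_union_right) x.2
  let E (n : ℕ) : (B (n + 1) →₀ R) →ₗ[R] Y (n + 1) :=
    F (n + 1) - (p.map (n + 1) ∘ₗ d (n + 1) + dY n ∘ₗ p.map n)
  have hE (n : ℕ) (x) (hx : x ∈ Finsupp.supported R R (p.carrier (n + 1))) : E n x = 0 := by
    simp [E, p.eq n x hx]
  have hEd (n : ℕ) (x) : E (n + 1) (d (n + 1) x) = dY (n + 1) (E n x) := by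
    have h1 := LinearMap.congr_fun (hF (n + 1)) x
    have h2 := LinearMap.congr_fun (hd (n + 1)) x
    have h3 := LinearMap.congr_fun (hdY n) (p.map n x)
    simp only [LinearMap.comp_apply, LinearMap.zero_apply] at h1 h2 h3
    simp [E, h1, h2, h3]
  have (n : ℕ) : Module.Finite R (Finsupp.supported R R (U n)) := by
    have : Finite (U n) := (hT n).subset Set.sdiff_subset
    exact Module.Finite.equiv (Finsupp.supportedEquivFinsupp (M := R) (R := R) (U n)).symm
  let Fb : ∀ n, Finsupp.supported R R (U n) →ₗ[R] Y n
    | 0 => 0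
    | n + 1 => E n ∘ₗ Submodule.subtype _
  obtain ⟨σ, hσ⟩ := hY.exists_homotopy_of_finite
    (P := fun n ↦ Finsupp.supported R R (U n))
    (dP := fun n ↦ ρ (n + 1) ∘ₗ d n ∘ₗ Submodule.subtype _)
    (fun n ↦ by
      ext1 x
      have h1 := hρ' (n + 1) _ (hST n (hU n x))
      have h2 := hρ _ _ (p.closed _ h1)
      have h3 := LinearMap.congr_fun (hd n) x.1
      simp only [LinearMap.comp_apply, LinearMap.zero_apply, map_sub] at h1 h2 h3 ⊢
      simpa [h3] using h2)
    hdY Fb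
    (fun n ↦ by
      ext1 x
      have h1 := hE _ _ (hρ' (n + 1) _ (hST n (hU n x)))
      rw [map_sub, sub_eq_zero] at h1
      cases n with
      | zero =>
        change E 0 (ρ 1 (d 0 x)) = _
        rw [← h1]
        have h2 := LinearMap.congr_fun (hF 0) x.1
        have h3 := LinearMap.congr_fun (hd 0) x.1
        have h4 : p.map 0 (d 0 x.1) = 0 := Subsingleton.elim _ _
        have h5 : F 0 x.1 = 0 := Subsingleton.elim _ _
        simp only [LinearMap.comp_apply, LinearMap.zero_apply] at h2 h3
        simp [E, h2, h3, h4, h5, Fb]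
      | succ n =>
        change E (n + 1) (ρ (n + 2) (d (n + 1) x)) = dY (n + 1) (E n x)
        rw [← h1, hEd])
  refine ⟨⟨fun n ↦ p.carrier n ∪ T n, fun n ↦ p.map n + σ n ∘ₗ ρ (n + 1), hST,
    fun n x hx ↦ ?_⟩, ⟨fun n ↦ Set.subset_union_left, fun n x hx ↦ ?_⟩,
    fun n ↦ Set.subset_union_right⟩
  · have h1 := hρ' _ x hx
    have h2 := hE _ _ h1
    have h3 := hρ _ _ (p.closed _ h1)
    have h4 := LinearMap.congr_fun (hσ n) (ρ (n + 1) x)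
    change E n (ρ (n + 1) x : B (n + 1) →₀ R) = σ (n + 1) (ρ (n + 2) (d (n + 1) (ρ (n + 1) x))) + dY n (σ n (ρ (n + 1) x)) at h4
    rw [map_sub, sub_eq_zero] at h2
    rw [map_sub, map_sub, sub_eq_zero] at h3
    rw [← h2, ← h3] at h4
    simp only [E, LinearMap.sub_apply, LinearMap.add_apply, LinearMap.comp_apply] at h4
    simp only [LinearMap.add_apply, LinearMap.comp_apply, map_add]
    rw [sub_eq_iff_eq_add] at h4
    rw [h4]
    abel
  · simp [hρ _ x hx]

end PartialHomotopy

/-- A chain map from a complex of free modules to a pure exact complex is null-homotopic. -/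
lemma PureExact.exists_homotopy_of_free {B : ℕ → Type u}
    {d : ∀ n, (B n →₀ R) →ₗ[R] (B (n + 1) →₀ R)} (hY : PureExact dY)
    (hd : ∀ n, d (n + 1) ∘ₗ d n = 0) (hdY : ∀ n, dY (n + 1) ∘ₗ dY n = 0)
    [Subsingleton (Y 0)] (F : ∀ n, (B n →₀ R) →ₗ[R] Y n)
    (hF : ∀ n, F (n + 1) ∘ₗ d n = dY n ∘ₗ F n) :
    ∃ s : ∀ n, (B (n + 1) →₀ R) →ₗ[R] Y n,
      ∀ n, F (n + 1) = s (n + 1) ∘ₗ d (n + 1) + dY n ∘ₗ s n := by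
  obtain ⟨m, hm⟩ := exists_maximal_of_chains_bounded
    (PartialHomotopy.exists_upperBound (d := d) (dY := dY) (F := F))
    PartialHomotopy.Extends.trans
  have htop (n : ℕ) : m.carrier n = Set.univ := by
    refine Set.eq_univ_of_forall fun b ↦ ?_
    let A (k : ℕ) : Set (B k) := {c | (⟨k, c⟩ : Σ k, B k) = ⟨n, b⟩}
    have hA (k : ℕ) : (A k).Finite := Set.Subsingleton.finite fun c hc c' hc' ↦
      sigma_mk_injective (hc.trans hc'.symm)
    obtain ⟨q, hq, hq'⟩ := m.exists_extends_of_finite hY hd hdY hF (dClosure d A)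
      (finite_dClosure d hA) (map_mem_supported_dClosure d A)
    exact (hm q hq).1 n (hq' n (subset_dClosure d A n rfl))
  refine ⟨m.map, fun n ↦ LinearMap.ext fun x ↦ m.eq n x ?_⟩
  rw [htop, Finsupp.supported_univ]
  trivial

/-- A chain map from a complex of projective modules to a pure exact complex is
null-homotopic. -/
theorem PureExact.exists_homotopy {P : ℕ → Type u} [∀ n, AddCommGroup (P n)]
    [∀ n, Module R (P n)] [∀ n, Module.Projective R (P n)] {dP : ∀ n, P n →ₗ[R] P (n + 1)}
    (hY : PureExact dY)
    (hdP : ∀ n, dP (n + 1) ∘ₗ dP n = 0) (hdY : ∀ n, dY (n + 1) ∘ₗ dY n = 0)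
    [Subsingleton (Y 0)] (F : ∀ n, P n →ₗ[R] Y n)
    (hF : ∀ n, F (n + 1) ∘ₗ dP n = dY n ∘ₗ F n) :
    ∃ s : ∀ n, P (n + 1) →ₗ[R] Y n,
      ∀ n, F (n + 1) = s (n + 1) ∘ₗ dP (n + 1) + dY n ∘ₗ s n := by
  choose i hi using fun n ↦ (Module.projective_def' (R := R) (P := P n)).mp inferInstance
  let π (n : ℕ) : (P n →₀ R) →ₗ[R] P n := Finsupp.linearCombination R id
  have hi' (n : ℕ) (x) : π n (i n x) = x := LinearMap.congr_fun (hi n) x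
  have hdP' (n : ℕ) (x) : dP (n + 1) (dP n x) = 0 := LinearMap.congr_fun (hdP n) x
  have hF' (n : ℕ) (x) : F (n + 1) (dP n x) = dY n (F n x) := LinearMap.congr_fun (hF n) x
  obtain ⟨s, hs⟩ := hY.exists_homotopy_of_free (B := P)
    (d := fun n ↦ i (n + 1) ∘ₗ dP n ∘ₗ π n)
    (fun n ↦ LinearMap.ext fun x ↦ by simp [hi', hdP']) hdY (fun n ↦ F n ∘ₗ π n)
    (fun n ↦ LinearMap.ext fun x ↦ by simp [hi', hF'])
  refine ⟨fun n ↦ s n ∘ₗ i (n + 1), fun n ↦ LinearMap.ext fun x ↦ ?_⟩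
  simpa [hi'] using LinearMap.congr_fun (hs n) (i (n + 1) x)

end Homotopy
section Cot

lemma mem_span_smul_iff {M ι : Type*} [AddCommGroup M] [Module R M] [Fintype ι] (w : ι → R)
    (N : Submodule R M) (x : M) :
    x ∈ Ideal.span (Set.range w) • N ↔
      ∃ f : ι → M, (∀ i, f i ∈ N) ∧ x = ∑ i, w i • f i := by
  constructor
  · intro hx
    induction hx using Submodule.smul_induction_on' with
    | smul r hr n hn =>
      obtain ⟨c, rfl⟩ := (Submodule.mem_span_range_iff_exists_fun R).mp hr
      exact ⟨fun i ↦ c i • n, fun i ↦ N.smul_mem _ hn, by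
        simp [Finset.sum_smul, smul_smul, mul_comm]⟩
    | add x hx y hy h h' =>
      obtain ⟨f, hf, rfl⟩ := h
      obtain ⟨g, hg, rfl⟩ := h'
      exact ⟨f + g, fun i ↦ N.add_mem (hf i) (hg i), by simp [Finset.sum_add_distrib]⟩
  · rintro ⟨f, hf, rfl⟩
    exact Submodule.sum_mem _ fun i _ ↦
      Submodule.smul_mem_smul (Ideal.subset_span (Set.mem_range_self i)) (hf i)

lemma exists_fin_span [IsNoetherianRing R] (I : Ideal R) :
    ∃ (k : ℕ) (w : Fin k → R), Ideal.span (Set.range w) = I := by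
  obtain ⟨k, w, hw⟩ := Submodule.fg_iff_exists_fin_generating_family.mp
    (IsNoetherian.noetherian I)
  exact ⟨k, w, hw⟩

lemma smul_top_inf_le_of_flat [IsNoetherianRing R] {L : Type*} [AddCommGroup L] [Module R L]
    (I : Ideal R) (K : Submodule R L) [Module.Flat R (L ⧸ K)] :
    I • (⊤ : Submodule R L) ⊓ K ≤ I • K := by
  obtain ⟨k, w, rfl⟩ := exists_fin_span I
  rintro x ⟨hx, hxK⟩
  obtain ⟨f, -, rfl⟩ := (mem_span_smul_iff w _ x).mp hx
  have h0 : ∑ i, w i • K.mkQ (f i) = 0 := by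
    simp_rw [← map_smul, ← map_sum]
    exact (Submodule.Quotient.mk_eq_zero K).mpr hxK
  obtain ⟨m, a, y, hy, ha⟩ := Module.Flat.isTrivialRelation_of_sum_smul_eq_zero h0
  choose z hz using fun j ↦ K.mkQ_surjective (y j)
  refine (mem_span_smul_iff w K _).mpr ⟨fun i ↦ f i - ∑ j, a i j • z j, fun i ↦ ?_, ?_⟩
  · rw [← Submodule.Quotient.mk_eq_zero, ← Submodule.mkQ_apply, map_sub, sub_eq_zero]
    exact (hy i).trans (by simp [hz])
  · simp_rw [smul_sub, Finset.sum_sub_distrib, Finset.smul_sum]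
    rw [Finset.sum_comm]
    simp_rw [smul_smul, ← Finset.sum_smul, ha]
    simp

/-- `C` has the extension property for inclusions into projective modules with flat cokernel. -/
def Cot (C : Type u) [AddCommGroup C] [Module R C] : Prop :=
  ∀ (L : Type u) [AddCommGroup L] [Module R L] [Module.Projective R L] (K : Submodule R L)
    [Module.Flat R (L ⧸ K)] (φ : K →ₗ[R] C), ∃ ψ : L →ₗ[R] C, ψ ∘ₗ K.subtype = φ

lemma injective_quotient_of_bijective (q : Ideal R) (W : Type u) [AddCommGroup W]
    [Module (R ⧸ q) W] [Module R W] [IsScalarTower R (R ⧸ q) W]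
    (hs : ∀ s ∉ q, Function.Bijective fun w : W ↦ s • w) : Module.Injective (R ⧸ q) W := by
  refine Module.Baer.injective fun J g ↦ ?_
  by_cases hJ : J = ⊥
  · refine ⟨0, fun x hx ↦ ?_⟩
    subst hJ
    rw [Submodule.mem_bot] at hx
    subst hx
    exact (map_zero g).symm
  obtain ⟨s, hsJ, hs0⟩ := Submodule.exists_mem_ne_zero_of_ne_bot hJ
  obtain ⟨s, rfl⟩ := Ideal.Quotient.mk_surjective s
  have hsq : s ∉ q := fun h ↦ hs0 (Ideal.Quotient.eq_zero_iff_mem.mpr h)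
  obtain ⟨w, hw⟩ := (hs s hsq).2 (g ⟨_, hsJ⟩)
  refine ⟨LinearMap.toSpanSingleton _ _ w, fun x hx ↦ (hs s hsq).1 ?_⟩
  have key (y : W) : s • y = (Ideal.Quotient.mk q s) • y := by
    rw [← algebraMap_smul (R ⧸ q) s y]; rfl
  simp only [LinearMap.toSpanSingleton_apply] at hw ⊢
  rw [key] at hw
  rw [key, key, smul_smul, mul_comm, ← smul_smul, hw, ← map_smul, ← map_smul]
  congr 1
  ext
  simp [mul_comm]

lemma Cot.of_bijective [IsNoetherianRing R] (q : Ideal R) (W : Type u) [AddCommGroup W]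
    [Module R W] (hq : ∀ a ∈ q, ∀ w : W, a • w = 0)
    (hs : ∀ s ∉ q, Function.Bijective fun w : W ↦ s • w) : Cot (R := R) W := by
  intro L _ _ _ K _ φ
  have hW : Module.IsTorsionBySet R W q := fun w a ↦ hq a a.2 w
  let _ := hW.module
  have : IsScalarTower R (R ⧸ q) W := hW.isScalarTower
  have hinj := injective_quotient_of_bijective q W hs
  let j : (K ⧸ (q • ⊤ : Submodule R K)) →ₗ[R] (L ⧸ (q • ⊤ : Submodule R L)) :=
    Submodule.mapQ _ _ K.subtype (by
      rw [← Submodule.map_le_iff_le_comap, Submodule.map_smul'']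
      exact Submodule.smul_mono le_rfl le_top)
  have hj : Function.Injective j := by
    rw [injective_iff_map_eq_zero]
    intro x hx
    obtain ⟨x, rfl⟩ := Submodule.mkQ_surjective _ x
    rw [Submodule.mkQ_apply, Submodule.mapQ_apply, Submodule.Quotient.mk_eq_zero] at hx
    rw [Submodule.mkQ_apply, Submodule.Quotient.mk_eq_zero, Submodule.mem_smul_top_iff]
    exact smul_top_inf_le_of_flat q K ⟨hx, x.2⟩
  let φ' : (K ⧸ (q • ⊤ : Submodule R K)) →ₗ[R] W := Submodule.liftQ _ φ (by
    rw [Submodule.smul_le]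
    intro a ha x _
    rw [LinearMap.mem_ker, map_smul, hq a ha])
  have hsurj : Function.Surjective (algebraMap R (R ⧸ q)) := Ideal.Quotient.mk_surjective
  obtain ⟨g, hg⟩ := hinj.out (j.extendScalarsOfSurjective hsurj) hj
    (φ'.extendScalarsOfSurjective hsurj)
  refine ⟨g.restrictScalars R ∘ₗ Submodule.mkQ _, LinearMap.ext fun x ↦ ?_⟩
  exact hg (Submodule.Quotient.mk x)

lemma Cot.exists_lift {V V' : Type u} [AddCommGroup V] [Module R V] [AddCommGroup V']
    [Module R V'] {π : V' →ₗ[R] V} (hπ : Function.Surjective π) (hker : Cot (R := R) (LinearMap.ker π))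
    {L : Type u} [AddCommGroup L] [Module R L] [Module.Projective R L] (K : Submodule R L)
    [Module.Flat R (L ⧸ K)] (φ : K →ₗ[R] V') (ψ : L →ₗ[R] V) (h : ψ ∘ₗ K.subtype = π ∘ₗ φ) :
    ∃ ψ' : L →ₗ[R] V', ψ' ∘ₗ K.subtype = φ ∧ π ∘ₗ ψ' = ψ := by
  obtain ⟨θ, hθ⟩ := Module.projective_lifting_property π ψ hπ
  obtain ⟨η, hη⟩ := hker L K ((φ - θ ∘ₗ K.subtype).codRestrict _ fun x ↦ by
    have h1 := LinearMap.congr_fun h x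
    have h2 := LinearMap.congr_fun hθ x
    simp only [LinearMap.comp_apply, Submodule.subtype_apply] at h1 h2
    simp [h2, h1])
  refine ⟨θ + Submodule.subtype _ ∘ₗ η, LinearMap.ext fun x ↦ ?_, LinearMap.ext fun x ↦ ?_⟩
  · have : (η x : V') = φ x - θ x := congr_arg Subtype.val (LinearMap.congr_fun hη x)
    simp [this]
  · rw [← hθ]
    simp

lemma Cot.pi {ι : Type u} (C : ι → Type u) [∀ i, AddCommGroup (C i)] [∀ i, Module R (C i)]
    (h : ∀ i, Cot (R := R) (C i)) : Cot (R := R) (∀ i, C i) := by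
  intro L _ _ _ K _ φ
  choose ψ hψ using fun i ↦ h i L K (LinearMap.proj i ∘ₗ φ)
  exact ⟨LinearMap.pi ψ, LinearMap.ext fun x ↦ funext fun i ↦ LinearMap.congr_fun (hψ i) x⟩

lemma Cot.ker_transitionMap [IsNoetherianRing R] (q : Ideal R) (M : Type u) [AddCommGroup M]
    [Module R M] (hs : ∀ s ∉ q, Function.Bijective fun m : M ↦ s • m) (n : ℕ) :
    Cot (R := R) (LinearMap.ker (AdicCompletion.transitionMap q M n.le_succ)) := by
  have hker (x : M) (hx : AdicCompletion.transitionMap q M n.le_succ (Submodule.Quotient.mk x) = 0) :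
      x ∈ (q ^ n • ⊤ : Submodule R M) :=
    (Submodule.Quotient.mk_eq_zero _).mp hx
  have hinv (s : R) (hsq : s ∉ q) (k : ℕ) (x : M) (hx : s • x ∈ (q ^ k • ⊤ : Submodule R M)) :
      x ∈ (q ^ k • ⊤ : Submodule R M) := by
    let e : M ≃ₗ[R] M := LinearEquiv.ofBijective (LinearMap.lsmul R M s) (hs s hsq)
    have h1 : (q ^ k • ⊤ : Submodule R M).map e.symm.toLinearMap ≤ q ^ k • ⊤ := by
      rw [Submodule.map_smul'']
      exact Submodule.smul_mono le_rfl le_top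
    have h2 : e.symm (s • x) = x := e.symm_apply_apply x
    rw [← h2]
    exact h1 (Submodule.mem_map_of_mem hx)
  refine Cot.of_bijective q _ ?_ ?_
  · rintro a ha ⟨x, hx⟩
    obtain ⟨x, rfl⟩ := Submodule.mkQ_surjective _ x
    ext
    change Submodule.Quotient.mk (a • x) = 0
    rw [Submodule.Quotient.mk_eq_zero, pow_succ', Submodule.mul_smul]
    exact Submodule.smul_mem_smul ha (hker x hx)
  · intro s hsq
    constructor
    · refine (injective_iff_map_eq_zero (LinearMap.lsmul R _ s)).mpr ?_
      rintro ⟨x, hx⟩ h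
      obtain ⟨x, rfl⟩ := Submodule.mkQ_surjective _ x
      ext
      exact (Submodule.Quotient.mk_eq_zero _).mpr
        (hinv s hsq _ x ((Submodule.Quotient.mk_eq_zero _).mp (congr_arg Subtype.val h)))
    · rintro ⟨x, hx⟩
      obtain ⟨x, rfl⟩ := Submodule.mkQ_surjective _ x
      obtain ⟨y, rfl⟩ := (hs s hsq).2 x
      refine ⟨⟨Submodule.Quotient.mk y, ?_⟩, rfl⟩
      exact (Submodule.Quotient.mk_eq_zero _).mpr (hinv s hsq n y (hker _ hx))

lemma Cot.adicCompletion [IsNoetherianRing R] (q : Ideal R) (M : Type u) [AddCommGroup M]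
    [Module R M] (hs : ∀ s ∉ q, Function.Bijective fun m : M ↦ s • m) :
    Cot (R := R) (AdicCompletion q M) := by
  intro L _ _ _ K _ φ
  have step (n : ℕ) (ψ : {ψ : L →ₗ[R] (M ⧸ (q ^ n • ⊤ : Submodule R M)) //
      ψ ∘ₗ K.subtype = AdicCompletion.eval q M n ∘ₗ φ}) :
      ∃ ψ' : {ψ : L →ₗ[R] (M ⧸ (q ^ (n + 1) • ⊤ : Submodule R M)) //
      ψ ∘ₗ K.subtype = AdicCompletion.eval q M (n + 1) ∘ₗ φ},
        AdicCompletion.transitionMap q M n.le_succ ∘ₗ ψ'.1 = ψ.1 := by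
    obtain ⟨ψ', h, h'⟩ := Cot.exists_lift (π := AdicCompletion.transitionMap q M n.le_succ)
      (Submodule.factor_surjective _) (Cot.ker_transitionMap q M hs n) K
      (AdicCompletion.eval q M (n + 1) ∘ₗ φ) ψ.1
      (by rw [ψ.2, ← LinearMap.comp_assoc, AdicCompletion.transitionMap_comp_eval])
    exact ⟨⟨ψ', h⟩, h'⟩
  choose g hg using step
  have h0 : Subsingleton (M ⧸ (q ^ 0 • ⊤ : Submodule R M)) := by
    rw [pow_zero, Ideal.one_eq_top, Submodule.top_smul]
    infer_instance
  let ψ (n : ℕ) : {ψ : L →ₗ[R] (M ⧸ (q ^ n • ⊤ : Submodule R M)) //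
      ψ ∘ₗ K.subtype = AdicCompletion.eval q M n ∘ₗ φ} :=
    Nat.rec ⟨0, LinearMap.ext fun x ↦ Subsingleton.elim _ _⟩ g n
  have hψ {m n : ℕ} (hle : m ≤ n) : AdicCompletion.transitionMap q M hle ∘ₗ (ψ n).1 = (ψ m).1 := by
    induction n, hle using Nat.le_induction with
    | base =>
      ext x
      obtain ⟨y, hy⟩ := Submodule.mkQ_surjective _ ((ψ m).1 x)
      rw [LinearMap.comp_apply, ← hy]
      exact Submodule.factor_mk _ _
    | succ n hle ih =>
      rw [← ih, ← hg n (ψ n), ← LinearMap.comp_assoc]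
      exact congr_arg (· ∘ₗ (ψ (n + 1)).1) (Submodule.factor_comp _ _).symm
  refine ⟨AdicCompletion.lift q (fun n ↦ (ψ n).1) hψ, LinearMap.ext fun x ↦ ?_⟩
  ext n
  exact LinearMap.congr_fun (ψ n).2 x

end Cot
section FlatEquations

variable {G : Type*} [AddCommGroup G] [Module R G]

lemma exists_factorization_of_flat [Module.Flat R G] {ι κ : Type*} [Fintype ι] [Fintype κ]
    [DecidableEq ι] (T : κ → ι → R) (x : ι → G) (h : ∀ j, ∑ i, T j i • x i = 0) :
    ∃ (k : ℕ) (α : Fin k → ι → R) (g : Fin k → G),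
      (∀ i, x i = ∑ l, α l i • g l) ∧ ∀ l j, ∑ i, T j i * α l i = 0 := by
  classical
  obtain ⟨k, a, y, hy, ha⟩ := Module.Flat.exists_factorization_of_comp_eq_zero_of_free
    (R := R) (f := Fintype.linearCombination R T) (x := Fintype.linearCombination R x)
    (LinearMap.pi_ext' fun j ↦ LinearMap.ext_ring (by
      simpa [Fintype.linearCombination_apply] using h j))
  refine ⟨k, fun l i ↦ a (Pi.single i 1) l, fun l ↦ y (Finsupp.single l 1), fun i ↦ ?_,
    fun l j ↦ ?_⟩
  · have h1 := LinearMap.congr_fun hy (Pi.single i 1)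
    rw [Fintype.linearCombination_apply_single, one_smul] at h1
    rw [h1, LinearMap.comp_apply]
    conv_lhs => rw [← Finsupp.univ_sum_single (a (Pi.single i 1)), map_sum]
    refine Finset.sum_congr rfl fun l _ ↦ ?_
    rw [← map_smul, Finsupp.smul_single, smul_eq_mul, mul_one]
  · have h1 := LinearMap.congr_fun ha (Pi.single j 1)
    rw [LinearMap.comp_apply, Fintype.linearCombination_apply_single, one_smul,
      ← Finset.univ_sum_single (T j), map_sum, LinearMap.zero_apply] at h1
    have h2 := DFunLike.congr_fun h1 l
    rw [Finsupp.finsetSum_apply, Finsupp.zero_apply] at h2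
    rw [← h2]
    refine Finset.sum_congr rfl fun i _ ↦ ?_
    rw [show Pi.single i (T j i) = T j i • (Pi.single i 1 : ι → R) by
      rw [← Pi.single_smul, smul_eq_mul, mul_one], map_smul, Finsupp.smul_apply, smul_eq_mul]

/-- `S` is a generating family of the module of relations between the elements `r`. -/
def Generates {ι μ : Type*} [Fintype ι] (r : ι → R) (S : μ → ι → R) : Prop :=
  (∀ l, ∑ i, r i * S l i = 0) ∧
    ∀ v : ι → R, ∑ i, r i * v i = 0 → v ∈ Submodule.span R (Set.range S)

lemma exists_generates [IsNoetherianRing R] {ι : Type*} [Fintype ι] (r : ι → R) :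
    ∃ (m : ℕ) (S : Fin m → ι → R), Generates r S := by
  let f : (ι → R) →ₗ[R] R := Fintype.linearCombination R r
  have hf (v : ι → R) : v ∈ LinearMap.ker f ↔ ∑ i, r i * v i = 0 := by
    simp [f, Fintype.linearCombination_apply, mul_comm]
  obtain ⟨m, S, hS⟩ := Submodule.fg_iff_exists_fin_generating_family.mp
    (IsNoetherian.noetherian (LinearMap.ker f))
  refine ⟨m, S, fun l ↦ ?_, fun v hv ↦ ?_⟩
  · rw [← hf, ← hS]
    exact Submodule.subset_span (Set.mem_range_self l)
  · rwa [hS, hf]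

lemma Generates.exists_eq_of_flat [Module.Flat R G] {ι μ : Type*} [Fintype ι] [Fintype μ]
    {r : ι → R} {S : μ → ι → R} (hS : Generates r S) (x : ι → G) (hx : ∑ i, r i • x i = 0) :
    ∃ y : μ → G, ∀ i, x i = ∑ l, S l i • y l := by
  classical
  obtain ⟨k, α, g, hg, hα⟩ := exists_factorization_of_flat (fun _ : Unit ↦ r) x fun _ ↦ hx
  choose c hc using fun l ↦
    (Submodule.mem_span_range_iff_exists_fun R).mp (hS.2 (α l) (hα l ()))
  refine ⟨fun s ↦ ∑ l, c l s • g l, fun i ↦ ?_⟩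
  rw [hg i]
  simp_rw [Finset.smul_sum]
  rw [Finset.sum_comm]
  refine Finset.sum_congr rfl fun l _ ↦ ?_
  rw [← hc l, Finset.sum_apply, Finset.sum_smul]
  refine Finset.sum_congr rfl fun s _ ↦ ?_
  rw [Pi.smul_apply, smul_eq_mul, mul_comm, mul_smul]

lemma flat_of_generates (hG : ∀ (k : ℕ) (r : Fin k → R), ∃ (m : ℕ) (S : Fin m → Fin k → R),
    Generates r S ∧ ∀ x : Fin k → G, ∑ i, r i • x i = 0 →
      ∃ y : Fin m → G, ∀ i, x i = ∑ l, S l i • y l) : Module.Flat R G := by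
  refine Module.Flat.of_forall_isTrivialRelation fun {k r x} hx ↦ ?_
  obtain ⟨m, S, hS, h⟩ := hG k r
  obtain ⟨y, hy⟩ := h x hx
  exact ⟨m, fun i l ↦ S l i, y, hy, hS.1⟩

lemma flat_pi [IsNoetherianRing R] {ι : Type*} (C : ι → Type*) [∀ i, AddCommGroup (C i)]
    [∀ i, Module R (C i)] [∀ i, Module.Flat R (C i)] : Module.Flat R (∀ i, C i) := by
  refine flat_of_generates fun k r ↦ ?_
  obtain ⟨m, S, hS⟩ := exists_generates r
  refine ⟨m, S, hS, fun x hx ↦ ?_⟩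
  choose y hy using fun i ↦ hS.exists_eq_of_flat (fun j ↦ x j i) (by
    simpa using congr_fun hx i)
  exact ⟨fun l i ↦ y i l, fun j ↦ funext fun i ↦ by simpa using hy i j⟩

lemma apply_mem_of_mem_smul_top {ι : Type*} (I : Ideal R) {v : ι → R}
    (hv : v ∈ (I • ⊤ : Submodule R (ι → R))) (i : ι) : v i ∈ I := by
  have h : I • (⊤ : Submodule R (ι → R)) ≤ Submodule.comap (LinearMap.proj (R := R) (φ := fun _ : ι ↦ R) i) I :=
    Submodule.smul_le.mpr fun a ha x _ ↦ I.mul_mem_right (x i) ha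
  exact h hv

lemma exists_artinRees_flat [IsNoetherianRing R] (I : Ideal R) {ι κ : Type*} [Fintype ι]
    [Fintype κ] (T : κ → ι → R) : ∃ a : ℕ, ∀ (G : Type u) [AddCommGroup G] [Module R G]
      [Module.Flat R G] (n : ℕ) (x : ι → G),
      (∀ j, ∑ i, T j i • x i ∈ (I ^ (n + a) • ⊤ : Submodule R G)) →
      ∃ x' : ι → G, (∀ i, x' i ∈ (I ^ n • ⊤ : Submodule R G)) ∧
        ∀ j, ∑ i, T j i • x' i = ∑ i, T j i • x i := by
  classical
  let t : (ι → R) →ₗ[R] (κ → R) :=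
    LinearMap.pi fun j ↦ Fintype.linearCombination R (T j)
  have ht (v) (j) : t v j = ∑ i, T j i * v i := by
    simp [t, Fintype.linearCombination_apply, mul_comm]
  obtain ⟨a, ha⟩ := Ideal.exists_pow_inf_eq_pow_smul I (LinearMap.range t)
  have hAR (n : ℕ) (v) (hv : t v ∈ (I ^ (n + a) • ⊤ : Submodule R (κ → R))) :
      ∃ v' ∈ (I ^ n • ⊤ : Submodule R (ι → R)), t v' = t v := by
    have h1 : t v ∈ I ^ (n + a) • ⊤ ⊓ LinearMap.range t := ⟨hv, v, rfl⟩
    rw [ha _ (Nat.le_add_left a n), Nat.add_sub_cancel] at h1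
    have h2 : t v ∈ (I ^ n • ⊤ : Submodule R (ι → R)).map t := by
      rw [Submodule.map_smul'', Submodule.map_top]
      exact Submodule.smul_mono le_rfl inf_le_right h1
    exact h2
  refine ⟨a, fun G _ _ _ n x hx ↦ ?_⟩
  obtain ⟨c, w, hw⟩ := exists_fin_span (I ^ (n + a))
  simp_rw [← hw, mem_span_smul_iff] at hx
  choose z _ hz using hx
  obtain ⟨k, α, g, hg, hα⟩ := exists_factorization_of_flat
    (fun (j : κ) ↦ Sum.elim (T j) fun s : Fin c × κ ↦ if s.2 = j then - w s.1 else 0)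
    (Sum.elim x fun s ↦ z s.2 s.1) (fun j ↦ by
      rw [Fintype.sum_sum_type]
      simp only [Sum.elim_inl, Sum.elim_inr, Fintype.sum_prod_type, ite_smul, zero_smul,
        Finset.sum_ite_eq', Finset.mem_univ, if_true, neg_smul, Finset.sum_neg_distrib, hz j]
      exact add_neg_cancel _)
  have hα' (l : Fin k) (j : κ) :
      ∑ i, T j i * α l (Sum.inl i) = ∑ s, w s * α l (Sum.inr (s, j)) := by
    have h1 := hα l j
    rw [Fintype.sum_sum_type] at h1
    simp only [Sum.elim_inl, Sum.elim_inr, Fintype.sum_prod_type, ite_mul, zero_mul,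
      Finset.sum_ite_eq', Finset.mem_univ, if_true, neg_mul, Finset.sum_neg_distrib] at h1
    exact add_neg_eq_zero.mp h1
  choose β hβ hβ' using fun l ↦ hAR n (fun i ↦ α l (Sum.inl i)) (by
    rw [← hw, mem_span_smul_iff]
    refine ⟨fun s j ↦ α l (Sum.inr (s, j)), fun _ ↦ trivial, funext fun j ↦ ?_⟩
    rw [ht, hα' l j]
    simp)
  refine ⟨fun i ↦ ∑ l, β l i • g l, fun i ↦ Submodule.sum_mem _ fun l _ ↦
    Submodule.smul_mem_smul (apply_mem_of_mem_smul_top _ (hβ l) i) trivial, fun j ↦ ?_⟩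
  have h1 (l) : ∑ i, T j i * β l i = ∑ i, T j i * α l (Sum.inl i) := by
    rw [← ht, hβ' l, ht]
  have h2 (γ : Fin k → ι → R) : ∑ i, T j i • ∑ l, γ l i • g l = ∑ l, (∑ i, T j i * γ l i) • g l := by
    simp_rw [Finset.smul_sum, Finset.sum_smul, smul_smul]
    exact Finset.sum_comm
  rw [h2]
  simp_rw [h1]
  rw [← h2 fun l i ↦ α l (Sum.inl i)]
  exact Finset.sum_congr rfl fun i _ ↦ by rw [← hg (Sum.inl i)]; rfl

theorem flat_adicCompletion [IsNoetherianRing R] (I : Ideal R) (G : Type u) [AddCommGroup G]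
    [Module R G] [Module.Flat R G] : Module.Flat R (AdicCompletion I G) := by
  refine flat_of_generates fun k r ↦ ?_
  obtain ⟨m, S, hS⟩ := exists_generates r
  refine ⟨m, S, hS, fun c hc ↦ ?_⟩
  obtain ⟨a, ha⟩ := exists_artinRees_flat I fun _ : Unit ↦ r
  obtain ⟨b, hb⟩ := exists_artinRees_flat I fun i l ↦ S l i
  have happ (n : ℕ) : ∃ y : Fin m → G, ∀ i, AdicCompletion.eval I G n (c i) =
      Submodule.mkQ _ (∑ l, S l i • y l) := by
    choose g hg using fun i ↦ Submodule.mkQ_surjective _ (AdicCompletion.eval I G (n + a) (c i))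
    obtain ⟨x', hx', hx''⟩ := ha G n g fun _ ↦ by
      rw [← Submodule.Quotient.mk_eq_zero, ← Submodule.mkQ_apply, map_sum]
      simp_rw [map_smul, hg, ← map_smul, ← map_sum, hc, map_zero]
    obtain ⟨y, hy⟩ := hS.exists_eq_of_flat (g - x') (by
      simp only [Pi.sub_apply, smul_sub, Finset.sum_sub_distrib, hx'' (), sub_self])
    refine ⟨y, fun i ↦ ?_⟩
    rw [← hy, Pi.sub_apply, map_sub, Submodule.mkQ_apply _ (x' i),
      (Submodule.Quotient.mk_eq_zero _).mpr (hx' i), sub_zero,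
      ← AdicCompletion.transitionMap_comp_eval I G (Nat.le_add_right n a), LinearMap.comp_apply,
      ← hg i]
    rfl
  have step (n : ℕ) (y : {y : Fin m → G // ∀ i, AdicCompletion.eval I G (n + b) (c i) =
      Submodule.mkQ _ (∑ l, S l i • y l)}) :
      ∃ y' : {y : Fin m → G // ∀ i, AdicCompletion.eval I G (n + 1 + b) (c i) =
        Submodule.mkQ _ (∑ l, S l i • y l)},
        ∀ l, y'.1 l - y.1 l ∈ (I ^ n • ⊤ : Submodule R G) := by
    obtain ⟨y, hy⟩ := y
    obtain ⟨y', hy'⟩ := happ (n + 1 + b)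
    obtain ⟨e, he, he'⟩ := hb G n (y' - y) fun i ↦ by
      simp only [Pi.sub_apply, smul_sub, Finset.sum_sub_distrib]
      rw [← Submodule.Quotient.mk_eq_zero, ← Submodule.mkQ_apply, map_sub, ← hy i, sub_eq_zero,
        ← AdicCompletion.transitionMap_comp_eval I G (show n + b ≤ n + 1 + b by omega),
        LinearMap.comp_apply, hy' i]
      rfl
    refine ⟨⟨y + e, fun i ↦ ?_⟩, fun l ↦ by simpa using he l⟩
    rw [hy' i]
    congr 1
    simp only [Pi.add_apply, smul_add, Finset.sum_add_distrib, he', Pi.sub_apply, smul_sub,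
      Finset.sum_sub_distrib]
    abel
  choose f hf using step
  let y (n : ℕ) : {y : Fin m → G // ∀ i, AdicCompletion.eval I G (n + b) (c i) =
      Submodule.mkQ _ (∑ l, S l i • y l)} :=
    Nat.rec ⟨(happ (0 + b)).choose, (happ (0 + b)).choose_spec⟩ f n
  refine ⟨fun l ↦ AdicCompletion.mk I G (AdicCompletion.AdicCauchySequence.mk I G
    (fun n ↦ (y n).1 l) fun n ↦ (SModEq.sub_mem.mpr (hf n (y n) l)).symm), fun i ↦ ?_⟩
  refine AdicCompletion.ext fun n ↦ ?_
  have h1 := (y n).2 i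
  change AdicCompletion.eval I G n (c i) = AdicCompletion.eval I G n _
  conv_lhs => rw [← AdicCompletion.transitionMap_comp_eval I G (Nat.le_add_right n b),
    LinearMap.comp_apply, h1]
  simp_rw [map_sum, map_smul]
  rfl

end FlatEquations
section FlatIntersections

variable {G : Type*} [AddCommGroup G] [Module R G] [Module.Flat R G]

lemma mem_inf_smul_top_of_flat [IsNoetherianRing R] (I J : Ideal R) {x : G}
    (hI : x ∈ (I • ⊤ : Submodule R G)) (hJ : x ∈ (J • ⊤ : Submodule R G)) :
    x ∈ ((I ⊓ J) • ⊤ : Submodule R G) := by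
  obtain ⟨m, a, rfl⟩ := exists_fin_span I
  obtain ⟨n, b, rfl⟩ := exists_fin_span J
  obtain ⟨g, _, hg⟩ := (mem_span_smul_iff _ _ _).mp hI
  obtain ⟨g', _, hg'⟩ := (mem_span_smul_iff _ _ _).mp hJ
  obtain ⟨k, α, y, hy, hα⟩ := exists_factorization_of_flat
    (fun _ : Unit ↦ Sum.elim a fun j ↦ - b j) (Sum.elim g g') (fun _ ↦ by
      simp [Fintype.sum_sum_type, ← hg, ← hg'])
  have hα' (l : Fin k) : ∑ i, a i * α l (Sum.inl i) = ∑ j, b j * α l (Sum.inr j) := by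
    have := hα l ()
    simp only [Fintype.sum_sum_type, Sum.elim_inl, Sum.elim_inr, neg_mul,
      Finset.sum_neg_distrib] at this
    exact add_neg_eq_zero.mp this
  have hx : x = ∑ l, (∑ i, a i * α l (Sum.inl i)) • y l := by
    rw [hg]
    simp_rw [Finset.sum_smul, mul_smul]
    rw [Finset.sum_comm]
    refine Finset.sum_congr rfl fun i _ ↦ ?_
    rw [show g i = Sum.elim g g' (Sum.inl i) from rfl, hy, Finset.smul_sum]
  rw [hx]
  refine Submodule.sum_mem _ fun l _ ↦ Submodule.smul_mem_smul ⟨?_, ?_⟩ trivial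
  · exact Submodule.sum_mem _ fun i _ ↦
      Ideal.mul_mem_right _ _ (Ideal.subset_span (Set.mem_range_self i))
  · rw [SetLike.mem_coe, hα']
    exact Submodule.sum_mem _ fun i _ ↦
      Ideal.mul_mem_right _ _ (Ideal.subset_span (Set.mem_range_self i))

lemma mem_smul_top_of_smul_mem_of_flat [IsNoetherianRing R] (J : Ideal R) {s : R}
    (hs : ∀ r, s * r ∈ J → r ∈ J) {x : G} (hx : s • x ∈ (J • ⊤ : Submodule R G)) :
    x ∈ (J • ⊤ : Submodule R G) := by
  obtain ⟨m, a, rfl⟩ := exists_fin_span J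
  obtain ⟨g, _, hg⟩ := (mem_span_smul_iff _ _ _).mp hx
  obtain ⟨k, α, y, hy, hα⟩ := exists_factorization_of_flat
    (fun _ : Unit ↦ Sum.elim (fun _ : Unit ↦ s) fun j ↦ - a j) (Sum.elim (fun _ ↦ x) g)
    (fun _ ↦ by simp [Fintype.sum_sum_type, ← hg])
  rw [show x = Sum.elim (fun _ ↦ x) g (Sum.inl ()) from rfl, hy]
  refine Submodule.sum_mem _ fun l _ ↦ Submodule.smul_mem_smul (hs _ ?_) trivial
  have := hα l ()
  simp only [Fintype.sum_sum_type, Sum.elim_inl, Sum.elim_inr, neg_mul,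
    Finset.sum_neg_distrib, Finset.univ_unique, Finset.sum_singleton] at this
  rw [show s * α l (Sum.inl ()) = _ from add_neg_eq_zero.mp this]
  exact Submodule.sum_mem _ fun i _ ↦
    Ideal.mul_mem_right _ _ (Ideal.subset_span (Set.mem_range_self i))

end FlatIntersections

lemma smul_top_eq_top_of_primes [IsNoetherianRing R] (G : Type*) [AddCommGroup G] [Module R G]
    (J : Ideal R) (h : ∀ q : Ideal R, q.IsPrime → J ≤ q → (q • ⊤ : Submodule R G) = ⊤) :
    (J • ⊤ : Submodule R G) = ⊤ := by
  induction J using IsNoetherian.induction with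
  | hgt J ih =>
    by_cases hJ : Ideal.IsPrime J
    · exact h J hJ le_rfl
    obtain rfl | ⟨x, hx, y, hy, hxy⟩ := Ideal.not_isPrime_iff.mp hJ
    · simp
    have key (z : R) (hz : z ∉ J) : ((J ⊔ Ideal.span {z}) • ⊤ : Submodule R G) = ⊤ := by
      refine ih _ (lt_of_le_of_ne le_sup_left fun h' ↦ hz ?_) fun q hq hJq ↦
        h q hq (le_sup_left.trans hJq)
      rw [h']
      exact Ideal.mem_sup_right (Ideal.mem_span_singleton_self z)
    rw [eq_top_iff]
    calc (⊤ : Submodule R G) = (J ⊔ Ideal.span {x}) • (J ⊔ Ideal.span {y}) • ⊤ := by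
          rw [key y hy, key x hx]
      _ = ((J ⊔ Ideal.span {x}) * (J ⊔ Ideal.span {y})) • ⊤ := (Submodule.mul_smul _ _ _).symm
      _ ≤ J • ⊤ := by
          refine Submodule.smul_mono_left ?_
          rw [Ideal.sup_mul, Ideal.mul_sup (Ideal.span {x}),
            Ideal.span_singleton_mul_span_singleton]
          exact sup_le (Ideal.mul_le.mpr fun a ha b _ ↦ Ideal.mul_mem_right b J ha) <|
            sup_le (Ideal.mul_le.mpr fun a _ b hb ↦ Ideal.mul_mem_left J a hb)
            ((Ideal.span_singleton_le_iff_mem _).mpr hxy)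

section LocalCompletion

variable (G : Type u) [AddCommGroup G] [Module R G]

/-- The completion of the localization of `G` at a prime. -/
abbrev LocalCompletion (q : PrimeSpectrum R) : Type u :=
  AdicCompletion q.asIdeal (LocalizedModule q.asIdeal.primeCompl G)

/-- The canonical map from `G` to the product of its local completions. -/
noncomputable def toLocalCompletions : G →ₗ[R] ∀ q : PrimeSpectrum R, LocalCompletion G q :=
  LinearMap.pi fun q ↦ AdicCompletion.of q.asIdeal _ ∘ₗ
    LocalizedModule.mkLinearMap q.asIdeal.primeCompl G

variable {G}

lemma bijective_smul_localizedModule (q : PrimeSpectrum R) (s : R) (hs : s ∉ q.asIdeal) :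
    Function.Bijective fun m : LocalizedModule q.asIdeal.primeCompl G ↦ s • m :=
  (Module.End.isUnit_iff _).mp
    (IsLocalizedModule.map_units (LocalizedModule.mkLinearMap q.asIdeal.primeCompl G)
      (⟨s, hs⟩ : q.asIdeal.primeCompl))

variable (G) in
lemma cot_localCompletions [IsNoetherianRing R] :
    Cot (R := R) (∀ q : PrimeSpectrum R, LocalCompletion G q) :=
  Cot.pi _ fun q ↦ Cot.adicCompletion _ _ (bijective_smul_localizedModule q)

variable (G) in
lemma flat_localCompletions [IsNoetherianRing R] [Module.Flat R G] :
    Module.Flat R (∀ q : PrimeSpectrum R, LocalCompletion G q) := by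
  have (q : PrimeSpectrum R) : Module.Flat R (LocalizedModule q.asIdeal.primeCompl G) :=
    have := IsLocalization.flat (Localization q.asIdeal.primeCompl) q.asIdeal.primeCompl
    Module.Flat.trans R (Localization q.asIdeal.primeCompl) _
  have (q : PrimeSpectrum R) : Module.Flat R (LocalCompletion G q) := flat_adicCompletion _ _
  exact flat_pi _

lemma exists_smul_mem_of_mkLinearMap_mem (S : Submonoid R) (J : Ideal R) (x : G)
    (hx : LocalizedModule.mkLinearMap S G x ∈ (J • ⊤ : Submodule R (LocalizedModule S G))) :
    ∃ s ∈ S, s • x ∈ (J • ⊤ : Submodule R G) := by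
  have h : ∀ y ∈ (J • ⊤ : Submodule R (LocalizedModule S G)), ∃ s ∈ S,
      ∃ z ∈ (J • ⊤ : Submodule R G), s • y = LocalizedModule.mkLinearMap S G z := by
    intro y hy
    refine Submodule.smul_induction_on hy (fun a ha m _ ↦ ?_) fun y y' ↦ ?_
    · obtain ⟨⟨z, s⟩, rfl⟩ := IsLocalizedModule.mk'_surjective S (LocalizedModule.mkLinearMap S G) m
      refine ⟨s, s.2, a • z, Submodule.smul_mem_smul ha trivial, ?_⟩
      rw [smul_comm, map_smul]
      congr 1
      exact IsLocalizedModule.mk'_cancel' (LocalizedModule.mkLinearMap S G) z s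
    · rintro ⟨s, hs, z, hz, h⟩ ⟨s', hs', z', hz', h'⟩
      refine ⟨s * s', mul_mem hs hs', s' • z + s • z',
        add_mem (Submodule.smul_mem _ _ hz) (Submodule.smul_mem _ _ hz'), ?_⟩
      rw [smul_add, map_add, map_smul, map_smul, ← h, ← h', smul_smul, smul_smul, mul_comm s' s]
  obtain ⟨s, hs, z, hz, h⟩ := h _ hx
  rw [← map_smul] at h
  obtain ⟨c, hc⟩ := (IsLocalizedModule.eq_iff_exists S _).mp h
  refine ⟨c * s, mul_mem c.2 hs, ?_⟩
  rw [mul_smul]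
  change c • s • x ∈ _
  rw [hc]
  exact Submodule.smul_mem _ _ hz

lemma mem_smul_top_of_toLocalCompletions_mem [IsNoetherianRing R] [Module.Flat R G] (J : Ideal R)
    (x : G) (hx : toLocalCompletions (R := R) G x ∈
      (J • ⊤ : Submodule R (∀ q : PrimeSpectrum R, LocalCompletion G q))) :
    x ∈ (J • ⊤ : Submodule R G) := by
  induction J using IsNoetherian.induction with
  | hgt J ih =>
    have ih' (I : Ideal R) (hI : J < I) : x ∈ (I • ⊤ : Submodule R G) :=
      ih I hI (Submodule.smul_mono_left hI.le hx)
    by_contra hxJ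
    have hJ : InfIrred J := by
      refine ⟨fun h ↦ hxJ ?_, fun I I' hII' ↦ ?_⟩
      · rw [isMax_iff_eq_top.mp h, Submodule.top_smul]
        trivial
      · by_contra! hne
        refine hxJ (hII' ▸ mem_inf_smul_top_of_flat I I' (ih' I ?_) (ih' I' ?_))
        · exact lt_of_le_of_ne (hII' ▸ inf_le_left) (Ne.symm hne.1)
        · exact lt_of_le_of_ne (hII' ▸ inf_le_right) (Ne.symm hne.2)
    have hprim : J.IsPrimary := hJ.isPrimary
    obtain ⟨q, hq⟩ : ∃ q : PrimeSpectrum R, q.asIdeal = Ideal.radical J :=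
      ⟨⟨_, Ideal.isPrime_radical hprim⟩, rfl⟩
    obtain ⟨n, hn⟩ := Ideal.exists_radical_pow_le_of_fg J (IsNoetherian.noetherian _)
    rw [← hq] at hn
    let ρ := AdicCompletion.eval q.asIdeal (LocalizedModule q.asIdeal.primeCompl G) n ∘ₗ
      LinearMap.proj (R := R) (φ := LocalCompletion G) q
    have h1 : ρ (toLocalCompletions (R := R) G x) ∈ (J • ⊤ : Submodule R _) := by
      have := Submodule.mem_map_of_mem (f := ρ) hx
      rw [Submodule.map_smul''] at this
      exact Submodule.smul_mono le_rfl le_top this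
    have h2 : Submodule.mkQ _ (LocalizedModule.mkLinearMap q.asIdeal.primeCompl G x) ∈
        (J • ⊤ : Submodule R (LocalizedModule q.asIdeal.primeCompl G ⧸
          (q.asIdeal ^ n • ⊤ : Submodule R _))) := h1
    rw [← Submodule.range_mkQ, LinearMap.range_eq_map, ← Submodule.map_smul''] at h2
    obtain ⟨z, hz, hzx⟩ := h2
    have h3 : LocalizedModule.mkLinearMap q.asIdeal.primeCompl G x ∈
        (J • ⊤ : Submodule R (LocalizedModule q.asIdeal.primeCompl G)) := by
      have h4 := (Submodule.Quotient.eq _).mp hzx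
      have h5 := sub_mem hz (Submodule.smul_mono_left hn h4)
      rwa [sub_sub_cancel] at h5
    obtain ⟨s, hs, hsx⟩ := exists_smul_mem_of_mkLinearMap_mem _ J x h3
    refine hxJ (mem_smul_top_of_smul_mem_of_flat J (fun r hr ↦ ?_) hsx)
    rw [mul_comm] at hr
    exact ((Ideal.isPrimary_iff.mp hprim).2 hr).resolve_right (hq ▸ hs)

lemma toLocalCompletions_injective [IsNoetherianRing R] [Module.Flat R G] :
    Function.Injective (toLocalCompletions (R := R) G) := by
  rw [injective_iff_map_eq_zero]
  intro x hx
  have := mem_smul_top_of_toLocalCompletions_mem (⊥ : Ideal R) x (by simp [hx])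
  simpa using this

variable (G) in
lemma flat_quotient_range_toLocalCompletions [IsNoetherianRing R] [Module.Flat R G] :
    Module.Flat R ((∀ q : PrimeSpectrum R, LocalCompletion G q) ⧸
      LinearMap.range (toLocalCompletions (R := R) G)) := by
  have := flat_localCompletions (R := R) G
  refine flat_of_generates fun k r ↦ ?_
  obtain ⟨m, S, hS⟩ := exists_generates r
  refine ⟨m, S, hS, fun d hd ↦ ?_⟩
  choose c hc using fun i ↦ Submodule.mkQ_surjective _ (d i)
  simp_rw [← hc, ← map_smul, ← map_sum] at hd
  obtain ⟨x, hx⟩ := (Submodule.Quotient.mk_eq_zero _).mp hd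
  have hx' := mem_smul_top_of_toLocalCompletions_mem (Ideal.span (Set.range r)) x
    ((mem_span_smul_iff _ _ _).mpr ⟨c, fun _ ↦ trivial, hx⟩)
  obtain ⟨g, _, rfl⟩ := (mem_span_smul_iff _ _ _).mp hx'
  obtain ⟨y, hy⟩ := hS.exists_eq_of_flat (fun i ↦ c i - toLocalCompletions (R := R) G (g i)) (by
    simp_rw [smul_sub, Finset.sum_sub_distrib, ← map_smul, ← map_sum, hx, sub_self])
  refine ⟨fun l ↦ Submodule.mkQ _ (y l), fun i ↦ ?_⟩
  simp_rw [← map_smul, ← map_sum, ← hy, ← hc]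
  rw [map_sub, eq_comm, sub_eq_self]
  exact (Submodule.Quotient.mk_eq_zero _).mpr ⟨_, rfl⟩

end LocalCompletion

section Levels

/-- `G = q G` for all primes `q` of coheight less than `n`. -/
def DivisibleBelow (R : Type u) [CommRing R] (n : ℕ) (G : Type*) [AddCommGroup G] [Module R G] :
    Prop :=
  ∀ q : PrimeSpectrum R, Order.coheight q < n → (q.asIdeal • ⊤ : Submodule R G) = ⊤

lemma exists_forall_coheight_lt (hdim : ringKrullDim R < ⊤) :
    ∃ n : ℕ, ∀ q : PrimeSpectrum R, Order.coheight q < n := by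
  by_cases hR : Nonempty (PrimeSpectrum R)
  · have hbot : ringKrullDim R ≠ ⊥ := Order.krullDim_ne_bot_iff.mpr hR
    obtain ⟨m, hm⟩ := WithBot.ne_bot_iff_exists.mp hbot
    rw [← hm] at hdim
    have hm' : m < ⊤ := WithBot.coe_lt_coe.mp hdim
    obtain ⟨n, rfl⟩ := ENat.ne_top_iff_exists.mp hm'.ne
    refine ⟨n + 1, fun q ↦ ?_⟩
    have h : ((Order.coheight q : ℕ∞) : WithBot ℕ∞) ≤ (n : ℕ∞) := by
      rw [hm]
      exact Order.coheight_le_krullDim q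
    have h' : Order.coheight q ≤ (n : ℕ∞) := WithBot.coe_le_coe.mp h
    exact lt_of_le_of_lt h' (by exact_mod_cast n.lt_succ_self)
  · exact ⟨0, fun q ↦ absurd ⟨q⟩ hR⟩

lemma DivisibleBelow.subsingleton [IsNoetherianRing R] {n : ℕ} {G : Type*} [AddCommGroup G]
    [Module R G] (h : DivisibleBelow R n G)
    (hn : ∀ q : PrimeSpectrum R, Order.coheight q < n) : Subsingleton G := by
  have := smul_top_eq_top_of_primes G (⊥ : Ideal R) fun q hq _ ↦ h ⟨q, hq⟩ (hn _)
  rw [Submodule.bot_smul] at this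
  exact (Submodule.subsingleton_iff R).mp (subsingleton_of_bot_eq_top this)

variable {G : Type u} [AddCommGroup G] [Module R G]

lemma mk'_mem_smul_top (S : Submonoid R) (J : Ideal R) {z : G}
    (hz : z ∈ (J • ⊤ : Submodule R G)) (s : S) :
    IsLocalizedModule.mk' (LocalizedModule.mkLinearMap S G) z s ∈
      (J • ⊤ : Submodule R (LocalizedModule S G)) := by
  refine Submodule.smul_induction_on hz (fun a ha m _ ↦ ?_) fun x y hx hy ↦ ?_
  · rw [IsLocalizedModule.mk'_smul]
    exact Submodule.smul_mem_smul ha trivial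
  · rw [IsLocalizedModule.mk'_add]
    exact add_mem hx hy

lemma subsingleton_localCompletion {q : PrimeSpectrum R}
    (h : (q.asIdeal • ⊤ : Submodule R G) = ⊤) : Subsingleton (LocalCompletion G q) := by
  have h1 : (q.asIdeal • ⊤ : Submodule R (LocalizedModule q.asIdeal.primeCompl G)) = ⊤ := by
    rw [eq_top_iff]
    rintro y -
    obtain ⟨⟨z, s⟩, rfl⟩ := IsLocalizedModule.mk'_surjective q.asIdeal.primeCompl
      (LocalizedModule.mkLinearMap q.asIdeal.primeCompl G) y
    exact mk'_mem_smul_top _ _ (h.symm ▸ Submodule.mem_top) s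
  have h2 (n : ℕ) : (q.asIdeal ^ n • ⊤ :
      Submodule R (LocalizedModule q.asIdeal.primeCompl G)) = ⊤ := by
    induction n with
    | zero => simp
    | succ n ih => rw [pow_succ, Submodule.mul_smul, h1, ih]
  refine ⟨fun x y ↦ AdicCompletion.ext fun n ↦ ?_⟩
  have := Submodule.Quotient.subsingleton_iff.mpr (h2 n)
  exact Subsingleton.elim (AdicCompletion.eval q.asIdeal _ n x) (AdicCompletion.eval q.asIdeal _ n y)

lemma exists_sub_mem_smul_top [IsNoetherianRing R] (p : PrimeSpectrum R)
    (h : ∀ q : PrimeSpectrum R, p < q → (q.asIdeal • ⊤ : Submodule R G) = ⊤)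
    (y : LocalizedModule p.asIdeal.primeCompl G) :
    ∃ g : G, y - LocalizedModule.mkLinearMap p.asIdeal.primeCompl G g ∈
      (p.asIdeal • ⊤ : Submodule R (LocalizedModule p.asIdeal.primeCompl G)) := by
  obtain ⟨⟨z, s⟩, rfl⟩ := IsLocalizedModule.mk'_surjective p.asIdeal.primeCompl
    (LocalizedModule.mkLinearMap p.asIdeal.primeCompl G) y
  have htop := smul_top_eq_top_of_primes G (p.asIdeal ⊔ Ideal.span {(s : R)}) fun q hq hle ↦
    h ⟨q, hq⟩ (lt_of_le_of_ne (le_sup_left.trans hle) fun hpq ↦ s.2 <|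
      (congrArg PrimeSpectrum.asIdeal hpq).ge
        (hle (Ideal.mem_sup_right (Ideal.mem_span_singleton_self _))))
  rw [Submodule.sup_smul, Submodule.ideal_span_singleton_smul] at htop
  obtain ⟨a, ha, b, hb, hab⟩ := Submodule.mem_sup.mp (htop.symm ▸ Submodule.mem_top : z ∈ _)
  obtain ⟨g, _, rfl⟩ := (Submodule.mem_smul_pointwise_iff_exists _ _ _).mp hb
  refine ⟨g, ?_⟩
  rw [← IsLocalizedModule.mk'_cancel (LocalizedModule.mkLinearMap p.asIdeal.primeCompl G) g s]
  change IsLocalizedModule.mk' (LocalizedModule.mkLinearMap p.asIdeal.primeCompl G) z s - _ ∈ _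
  rw [← IsLocalizedModule.mk'_sub, ← hab]
  refine mk'_mem_smul_top _ _ ?_ s
  rwa [Submonoid.smul_def, add_sub_cancel_right]

lemma smul_top_eq_top_of_bijective (p : Ideal R) {M : Type*} [AddCommGroup M] [Module R M] {s : R}
    (hs : s ∈ p) (h : Function.Surjective fun m : M ↦ s • m) : (p • ⊤ : Submodule R M) = ⊤ := by
  rw [eq_top_iff]
  rintro x -
  obtain ⟨y, rfl⟩ := h x
  exact Submodule.smul_mem_smul hs trivial

lemma surjective_smul_adicCompletion (q : Ideal R) {M : Type*} [AddCommGroup M] [Module R M]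
    {s : R} (h : Function.Bijective fun m : M ↦ s • m) :
    Function.Surjective fun m : AdicCompletion q M ↦ s • m := by
  let e : M ≃ₗ[R] M := LinearEquiv.ofBijective (LinearMap.lsmul R M s) h
  intro x
  refine ⟨AdicCompletion.map q e.symm.toLinearMap x, AdicCompletion.ext fun n ↦ ?_⟩
  obtain ⟨y, hy⟩ := Submodule.mkQ_surjective _ (x.val n)
  change s • (e.symm.toLinearMap.reduceModIdeal (q ^ n)) (x.val n) = x.val n
  rw [← hy]
  change Submodule.mkQ _ (s • e.symm y) = _
  exact congrArg _ (e.apply_symm_apply y)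

lemma mem_smul_top_pi [IsNoetherianRing R] (p : Ideal R) {ι : Type*} (C : ι → Type*)
    [∀ i, AddCommGroup (C i)] [∀ i, Module R (C i)] (c : ∀ i, C i)
    (h : ∀ i, c i ∈ (p • ⊤ : Submodule R (C i))) : c ∈ (p • ⊤ : Submodule R (∀ i, C i)) := by
  obtain ⟨k, w, rfl⟩ := exists_fin_span p
  simp_rw [mem_span_smul_iff] at h
  choose f _ hf using h
  exact (mem_span_smul_iff _ _ _).mpr ⟨fun j i ↦ f i j, fun _ ↦ trivial, funext fun i ↦ by
    simp [hf i]⟩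

lemma DivisibleBelow.succ [IsNoetherianRing R] {n : ℕ} (hG : DivisibleBelow R n G) :
    DivisibleBelow R (n + 1) ((∀ q : PrimeSpectrum R, LocalCompletion G q) ⧸
      LinearMap.range (toLocalCompletions (R := R) G)) := by
  intro p hp
  have hp' : Order.coheight p ≤ n :=
    (ENat.lt_add_one_iff (ENat.natCast_ne_top n)).mp (by exact_mod_cast hp)
  have hcoh (q : PrimeSpectrum R) (hq : p < q) : Order.coheight q < n :=
    lt_of_lt_of_le (Order.coheight_strictAnti hq <| lt_of_le_of_lt
      ((Order.coheight_anti hq.le).trans hp') (ENat.natCast_lt_top n)) hp'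
  have hlt (q : PrimeSpectrum R) (hq : p < q) : (q.asIdeal • ⊤ : Submodule R G) = ⊤ :=
    hG q (hcoh q hq)
  rw [eq_top_iff]
  rintro d -
  obtain ⟨c, rfl⟩ := Submodule.mkQ_surjective _ d
  obtain ⟨y, hy⟩ := Submodule.mkQ_surjective _ (AdicCompletion.eval p.asIdeal _ 1 (c p))
  obtain ⟨g, hg⟩ := exists_sub_mem_smul_top p hlt y
  have key : c - toLocalCompletions (R := R) G g ∈ (p.asIdeal • ⊤ : Submodule R _) := by
    refine mem_smul_top_pi _ _ _ fun q ↦ ?_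
    by_cases hqn : Order.coheight q < n
    · have := subsingleton_localCompletion (hG q hqn)
      rw [Subsingleton.elim ((c - toLocalCompletions (R := R) G g) q) 0]
      exact zero_mem _
    by_cases hqp : q = p
    · subst hqp
      have h1 := AdicCompletion.pow_smul_top_eq_ker_eval (n := 1) (I := q.asIdeal)
        (M := LocalizedModule q.asIdeal.primeCompl G) (IsNoetherian.noetherian _)
      refine (congrArg (fun I : Ideal R ↦ (I • ⊤ : Submodule R (LocalCompletion G q)))
        (pow_one q.asIdeal)).le (h1.ge ?_)
      rw [LinearMap.mem_ker, Pi.sub_apply, map_sub, ← hy]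
      change Submodule.mkQ _ y - Submodule.mkQ _ (LocalizedModule.mkLinearMap _ G g) = 0
      rw [← map_sub, Submodule.mkQ_apply, Submodule.Quotient.mk_eq_zero, pow_one]
      exact hg
    · obtain ⟨s, hs, hsq⟩ : ∃ s ∈ p.asIdeal, s ∉ q.asIdeal := by
        by_contra! hle
        exact hqn (hcoh q (lt_of_le_of_ne hle (Ne.symm hqp)))
      rw [smul_top_eq_top_of_bijective p.asIdeal hs (surjective_smul_adicCompletion q.asIdeal
        (bijective_smul_localizedModule q s hsq))]
      trivial
  have h2 := Submodule.mem_map_of_mem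
    (f := Submodule.mkQ (LinearMap.range (toLocalCompletions (R := R) G))) key
  rw [Submodule.map_smul''] at h2
  have h3 := Submodule.smul_mono (le_refl p.asIdeal) le_top h2
  rwa [map_sub, Submodule.mkQ_apply _ (toLocalCompletions (R := R) G g),
    (Submodule.Quotient.mk_eq_zero _).mpr (LinearMap.mem_range_self _ g), sub_zero] at h3

end Levels

lemma exists_desc {L F D : Type*} [AddCommGroup L] [Module R L] [AddCommGroup F] [Module R F]
    [AddCommGroup D] [Module R D] (π : L →ₗ[R] F) (hπ : Function.Surjective π) (g : L →ₗ[R] D)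
    (h : ∀ x, π x = 0 → g x = 0) : ∃ g' : F →ₗ[R] D, ∀ x, g' (π x) = g x := by
  refine ⟨(LinearMap.ker π).liftQ g (fun x hx ↦ h x hx) ∘ₗ
    (π.quotKerEquivOfSurjective hπ).symm.toLinearMap, fun x ↦ ?_⟩
  have h1 : (π.quotKerEquivOfSurjective hπ).symm (π x) = Submodule.mkQ _ x := by
    rw [LinearEquiv.symm_apply_eq]
    rfl
  rw [LinearMap.comp_apply, LinearEquiv.coe_coe, h1]
  rfl

section DimensionShift

lemma flat_ker [IsNoetherianRing R] {L F : Type*} [AddCommGroup L] [Module R L] [AddCommGroup F]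
    [Module R F] [Module.Flat R L] [Module.Flat R F] (π : L →ₗ[R] F)
    (hπ : Function.Surjective π) : Module.Flat R (LinearMap.ker π) := by
  refine flat_of_generates fun k r ↦ ?_
  obtain ⟨m, S, hS⟩ := exists_generates r
  refine ⟨m, S, hS, fun x hx ↦ ?_⟩
  obtain ⟨y, hy⟩ := hS.exists_eq_of_flat (fun i ↦ (x i : L)) (by
    simpa using congrArg (LinearMap.ker π).subtype hx)
  obtain ⟨c, α, g, hg, hα⟩ := exists_factorization_of_flat (fun i l ↦ S l i) (fun l ↦ π (y l))
    fun i ↦ by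
      simp_rw [← map_smul, ← map_sum, ← hy]
      exact (x i).2
  choose g' hg' using fun j ↦ hπ (g j)
  refine ⟨fun l ↦ ⟨y l - ∑ j, α j l • g' j, ?_⟩, fun i ↦ Subtype.ext ?_⟩
  · rw [LinearMap.mem_ker, map_sub, hg l, map_sum]
    simp [hg']
  · rw [hy i]
    simp only [AddSubmonoidClass.coe_finsetSum, SetLike.val_smul, smul_sub,
      Finset.sum_sub_distrib, Finset.smul_sum, smul_smul]
    rw [eq_comm, sub_eq_self, Finset.sum_comm]
    simp [← Finset.sum_smul, hα]

/-- The iterated kernels of the canonical free resolution of `F`. -/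
noncomputable def syzygy (F : ModuleCat.{u} R) : ℕ → ModuleCat.{u} R
  | 0 => F
  | n + 1 => ModuleCat.of R
      (LinearMap.ker (Finsupp.linearCombination R (id : syzygy F n → syzygy F n)))

/-- The canonical free cover of `M`. -/
noncomputable abbrev freeCover (M : Type u) [AddCommGroup M] [Module R M] : (M →₀ R) →ₗ[R] M :=
  Finsupp.linearCombination R (id : M → M)

lemma freeCover_surjective (M : Type u) [AddCommGroup M] [Module R M] :
    Function.Surjective (freeCover (R := R) M) :=
  Finsupp.linearCombination_id_surjective R M

/-- The inclusion of a syzygy. -/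
noncomputable def syzygyι (F : ModuleCat.{u} R) (n : ℕ) :
    syzygy F (n + 1) →ₗ[R] (syzygy F n →₀ R) :=
  Submodule.subtype _

lemma syzygyι_mem_ker (F : ModuleCat.{u} R) (n : ℕ) (x : syzygy F (n + 1)) :
    freeCover (R := R) (syzygy F n) (syzygyι F n x) = 0 :=
  LinearMap.mem_ker.mp (Subtype.property x)

lemma flat_syzygy [IsNoetherianRing R] (F : ModuleCat.{u} R) [Module.Flat R F] (n : ℕ) :
    Module.Flat R (syzygy F n) := by
  induction n with
  | zero => assumption
  | succ n ih => exact flat_ker _ (freeCover_surjective (syzygy F n))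

lemma exists_extension_of_divisibleBelow [IsNoetherianRing R] {n : ℕ}
    (hn : ∀ q : PrimeSpectrum R, Order.coheight q < n) (F : ModuleCat.{u} R) [Module.Flat R F]
    (m k : ℕ) (hmk : k + m = n) (G : Type u) [AddCommGroup G] [Module R G] [Module.Flat R G]
    (hG : DivisibleBelow R k G) (f : syzygy F (m + 1) →ₗ[R] G) :
    ∃ ψ : (syzygy F m →₀ R) →ₗ[R] G, ψ ∘ₗ syzygyι F m = f := by
  induction m generalizing k G with
  | zero =>
    obtain rfl : k = n := hmk
    have := hG.subsingleton hn
    exact ⟨0, LinearMap.ext fun _ ↦ Subsingleton.elim _ _⟩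
  | succ m ih =>
    let C := ∀ q : PrimeSpectrum R, LocalCompletion G q
    let t : G →ₗ[R] C := toLocalCompletions (R := R) G
    let D := C ⧸ LinearMap.range t
    have hD : Module.Flat R D := flat_quotient_range_toLocalCompletions G
    have hflat := flat_syzygy F (m + 1)
    let π := freeCover (R := R) (syzygy F (m + 1))
    have hLK : Module.Flat R ((syzygy F (m + 1) →₀ R) ⧸ LinearMap.ker π) :=
      Module.Flat.of_linearEquiv
        (π.quotKerEquivOfSurjective (freeCover_surjective (syzygy F (m + 1))))
    obtain ⟨ψ, hψ⟩ := cot_localCompletions (R := R) G _ (LinearMap.ker π) (t ∘ₗ f)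
    have hψ' (x) : ψ (syzygyι F (m + 1) x) = t (f x) := LinearMap.congr_fun hψ x
    obtain ⟨ψ₁, hψ₁⟩ := exists_desc π (freeCover_surjective (syzygy F (m + 1)))
      (Submodule.mkQ (LinearMap.range t) ∘ₗ ψ) fun x hx ↦
        (Submodule.Quotient.mk_eq_zero _).mpr ⟨f ⟨x, hx⟩, (hψ' ⟨x, hx⟩).symm⟩
    obtain ⟨θ, hθ⟩ := ih (k + 1) (by omega) D hG.succ ψ₁
    obtain ⟨θ', hθ'⟩ := Module.projective_lifting_property
      (Submodule.mkQ (LinearMap.range t)) θ (Submodule.mkQ_surjective _)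
    let ρ : (syzygy F (m + 1) →₀ R) →ₗ[R] C := ψ - θ' ∘ₗ syzygyι F m ∘ₗ π
    have hρ (x) : ρ x ∈ LinearMap.range t := by
      rw [← Submodule.Quotient.mk_eq_zero, ← Submodule.mkQ_apply]
      change Submodule.mkQ _ (ψ x - θ' (syzygyι F m (π x))) = 0
      rw [map_sub, ← LinearMap.comp_apply, ← hψ₁, ← hθ, ← hθ', sub_eq_zero]
      rfl
    let e := LinearEquiv.ofInjective t toLocalCompletions_injective
    refine ⟨e.symm.toLinearMap ∘ₗ ρ.codRestrict (LinearMap.range t) hρ, LinearMap.ext fun x ↦ ?_⟩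
    change e.symm ⟨ρ (syzygyι F (m + 1) x), _⟩ = f x
    rw [LinearEquiv.symm_apply_eq]
    refine Subtype.ext ?_
    change ψ _ - θ' (syzygyι F m (π (syzygyι F (m + 1) x))) = t (f x)
    rw [syzygyι_mem_ker, map_zero, map_zero, sub_zero, hψ']

theorem exists_projective_syzygy [IsNoetherianRing R] (hdim : ringKrullDim R < ⊤) :
    ∃ n : ℕ, ∀ (F : ModuleCat.{u} R) [Module.Flat R F], Module.Projective R (syzygy F (n + 1)) := by
  obtain ⟨n, hn⟩ := exists_forall_coheight_lt hdim
  refine ⟨n, fun F _ ↦ ?_⟩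
  have := flat_syzygy F (n + 1)
  obtain ⟨ψ, hψ⟩ := exists_extension_of_divisibleBelow hn F n 0 (zero_add n) (syzygy F (n + 1))
    (fun q hq ↦ by simp at hq) LinearMap.id
  exact Module.Projective.of_split (syzygyι F n) ψ hψ

end DimensionShift

section TotallyAcyclic

/-- A totally acyclic complex of projective modules. -/
structure IsTotallyAcyclic (C : ChainComplex (ModuleCat.{u} R) ℤ) : Prop where
  projective : ∀ i, Projective (C.X i)
  exactAt : ∀ i, C.ExactAt i
  exists_lift : ∀ P : ModuleCat.{u} R, Projective P →
    ∀ (i : ℤ) (f : C.X i ⟶ P), C.d (i + 1) i ≫ f = 0 →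
      ∃ g : C.X (i - 1) ⟶ P, f = C.d i (i - 1) ≫ g

/-- The differential of a complex as a linear map. -/
abbrev dl (C : ChainComplex (ModuleCat.{u} R) ℤ) (i j : ℤ) : C.X i →ₗ[R] C.X j := (C.d i j).hom

lemma dl_dl (C : ChainComplex (ModuleCat.{u} R) ℤ) (i j k : ℤ) (x : C.X i) :
    dl C j k (dl C i j x) = 0 :=
  LinearMap.congr_fun (congrArg ModuleCat.Hom.hom (C.d_comp_d i j k)) x

/-- `Hom(C, N)` is exact for all totally acyclic complexes of projective modules `C`. -/
def HomAcyclic (N : Type u) [AddCommGroup N] [Module R N] : Prop :=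
  ∀ C : ChainComplex (ModuleCat.{u} R) ℤ, IsTotallyAcyclic C → ∀ i j k : ℤ, j + 1 = i → k + 1 = j →
    ∀ f : C.X j →ₗ[R] N, (∀ x, f (dl C i j x) = 0) → ∃ g : C.X k →ₗ[R] N, ∀ x, f x = g (dl C j k x)

lemma IsTotallyAcyclic.module_projective {C : ChainComplex (ModuleCat.{u} R) ℤ}
    (hC : IsTotallyAcyclic C) (i : ℤ) : Module.Projective R (C.X i) :=
  (IsProjective.iff_projective _).mpr (hC.projective i)

lemma exists_eq_of_exactAt {C : ChainComplex (ModuleCat.{u} R) ℤ} {i j k : ℤ}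
    (hC : C.ExactAt j) (hi : j + 1 = i) (hk : k + 1 = j) (x : C.X j) (hx : dl C j k x = 0) :
    ∃ y, dl C i j y = x :=
  (ShortComplex.moduleCat_exact_iff _).mp ((HomologicalComplex.exactAt_iff' C i j k
    ((ComplexShape.down ℤ).prev_eq' hi) ((ComplexShape.down ℤ).next_eq' hk)).mp hC) x hx

lemma exactAt_of_exists_eq {C : ChainComplex (ModuleCat.{u} R) ℤ} {i j k : ℤ}
    (hi : j + 1 = i) (hk : k + 1 = j) (h : ∀ x, dl C j k x = 0 → ∃ y, dl C i j y = x) :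
    C.ExactAt j :=
  (HomologicalComplex.exactAt_iff' C i j k
    ((ComplexShape.down ℤ).prev_eq' hi) ((ComplexShape.down ℤ).next_eq' hk)).mpr
      ((ShortComplex.moduleCat_exact_iff _).mpr h)

lemma HomAcyclic.of_projective (N : Type u) [AddCommGroup N] [Module R N] [Module.Projective R N] :
    HomAcyclic (R := R) N := by
  rintro C hC i j k rfl hk f hf
  obtain rfl : k = j - 1 := by omega
  obtain ⟨g, hg⟩ := hC.exists_lift (ModuleCat.of R N)
    ((IsProjective.iff_projective _).mp inferInstance) j (ModuleCat.ofHom f)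
    (ModuleCat.hom_ext (LinearMap.ext hf))
  exact ⟨g.hom, fun x ↦ LinearMap.congr_fun (congrArg ModuleCat.Hom.hom hg) x⟩

lemma HomAcyclic.of_retract {N N' : Type u} [AddCommGroup N] [Module R N] [AddCommGroup N']
    [Module R N'] (h : HomAcyclic (R := R) N) (ι : N' →ₗ[R] N) (ρ : N →ₗ[R] N')
    (hρ : ∀ x, ρ (ι x) = x) : HomAcyclic (R := R) N' := by
  intro C hC i j k hi hk f hf
  obtain ⟨g, hg⟩ := h C hC i j k hi hk (ι ∘ₗ f) fun x ↦ by simp [hf]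
  exact ⟨ρ ∘ₗ g, fun x ↦ by rw [LinearMap.comp_apply, ← hg, LinearMap.comp_apply, hρ]⟩

lemma HomAcyclic.of_exact {K L F : Type u} [AddCommGroup K] [Module R K] [AddCommGroup L]
    [Module R L] [AddCommGroup F] [Module R F] (hK : HomAcyclic (R := R) K)
    (hL : HomAcyclic (R := R) L) (ι : K →ₗ[R] L) (π : L →ₗ[R] F) (hι : Function.Injective ι)
    (hιπ : LinearMap.range ι = LinearMap.ker π) (hπ : Function.Surjective π) :
    HomAcyclic (R := R) F := by
  intro C hC i j k hi hk f hf
  have := hC.module_projective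
  obtain ⟨f', hf'⟩ := Module.projective_lifting_property π f hπ
  have hf'' (x) : π (f' x) = f x := LinearMap.congr_fun hf' x
  let e := LinearEquiv.ofInjective ι hι
  have hmem (x) : f' (dl C i j x) ∈ LinearMap.range ι := by
    rw [hιπ, LinearMap.mem_ker, hf'', hf]
  obtain ⟨u, hu⟩ := hK C hC (i + 1) i j rfl hi
    (e.symm.toLinearMap ∘ₗ (f' ∘ₗ dl C i j).codRestrict (LinearMap.range ι) hmem) fun x ↦ by
      rw [LinearMap.comp_apply, LinearEquiv.coe_coe, LinearEquiv.symm_apply_eq, map_zero]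
      exact Subtype.ext (by
        change f' (dl C i j (dl C (i + 1) i x)) = 0
        rw [dl_dl, map_zero])
  have hu' (x) : f' (dl C i j x) = ι (u (dl C i j x)) := by
    rw [← hu]
    have := e.apply_symm_apply ⟨f' (dl C i j x), hmem x⟩
    exact (congrArg Subtype.val this).symm
  obtain ⟨g, hg⟩ := hL C hC i j k hi hk (f' - ι ∘ₗ u) fun x ↦ by simp [hu']
  have hπι (y) : π (ι y) = 0 := by
    rw [← LinearMap.mem_ker, ← hιπ]
    exact LinearMap.mem_range_self ι y
  refine ⟨π ∘ₗ g, fun x ↦ ?_⟩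
  rw [LinearMap.comp_apply, ← hg, LinearMap.sub_apply, map_sub, hf'', LinearMap.comp_apply, hπι,
    sub_zero]

theorem HomAcyclic.of_flat [IsNoetherianRing R] (hdim : ringKrullDim R < ⊤) (F : Type u)
    [AddCommGroup F] [Module R F] [Module.Flat R F] : HomAcyclic (R := R) F := by
  obtain ⟨n, hn⟩ := exists_projective_syzygy hdim
  have key (m k : ℕ) (h : k + m = n + 1) :
      HomAcyclic (R := R) (syzygy (ModuleCat.of R F) k) := by
    induction m generalizing k with
    | zero =>
      obtain rfl : k = n + 1 := h
      have := hn (ModuleCat.of R F)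
      exact .of_projective _
    | succ m ih =>
      exact .of_exact (ih (k + 1) (by omega)) (.of_projective _) (syzygyι _ k)
        (freeCover (syzygy (ModuleCat.of R F) k)) Subtype.val_injective
        (Submodule.range_subtype _) (freeCover_surjective _)
  exact key (n + 1) 0 (zero_add _)

end TotallyAcyclic

section Characters

lemma characterModule_sum_apply {ι A : Type*} [AddCommGroup A] (s : Finset ι)
    (χ : ι → CharacterModule A) (a : A) : (∑ i ∈ s, χ i) a = ∑ i ∈ s, χ i a :=
  AddMonoidHom.finsetSum_apply _ _ _

section

variable {A B : Type*} [AddCommGroup A] [AddCommGroup B] [Module R A] [Module R B]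

lemma exists_character_comp_eq (f : A →ₗ[R] B) (χ : CharacterModule A)
    (h : ∀ x, f x = 0 → χ x = 0) : ∃ ψ : CharacterModule B, ∀ x, ψ (f x) = χ x := by
  obtain ⟨g, hg⟩ := exists_desc (R := ℤ) (f.rangeRestrict.restrictScalars ℤ)
    f.surjective_rangeRestrict (AddMonoidHom.toIntLinearMap χ)
    fun x hx ↦ h x (congrArg Subtype.val hx)
  obtain ⟨ψ, hψ⟩ := CharacterModule.dual_surjective_of_injective (LinearMap.range f).subtype
    Subtype.val_injective g.toAddMonoidHom
  exact ⟨ψ, fun x ↦ (DFunLike.congr_fun hψ (f.rangeRestrict x)).trans (hg x)⟩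

lemma mem_of_forall_character (N : Submodule R A) (a : A)
    (h : ∀ χ : CharacterModule A, (∀ x ∈ N, χ x = 0) → χ a = 0) : a ∈ N := by
  rw [← Submodule.Quotient.mk_eq_zero]
  refine CharacterModule.eq_zero_of_character_apply fun χ ↦ ?_
  refine h (CharacterModule.dual N.mkQ χ) fun x hx ↦ ?_
  change χ (Submodule.Quotient.mk x) = 0
  rw [(Submodule.Quotient.mk_eq_zero N).mpr hx, map_zero]

variable (R A) in
/-- The canonical map to the double character module. -/
def evalCharacter : A →ₗ[R] CharacterModule (CharacterModule A) where
  toFun a := AddMonoidHom.mk' (fun χ : CharacterModule A ↦ χ a) fun _ _ ↦ rfl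
  map_add' a b := CharacterModule.ext _ fun χ ↦ map_add χ a b
  map_smul' _ _ := rfl

variable (R A) in
lemma evalCharacter_injective : Function.Injective (evalCharacter R A) :=
  (injective_iff_map_eq_zero _).mpr fun _ ha ↦
    CharacterModule.eq_zero_of_character_apply fun χ ↦ DFunLike.congr_fun ha χ

end

lemma exists_eq_smul_of_injective {I : Type u} [AddCommGroup I] [Module R I] [Module.Injective R I]
    {k m : ℕ} {r : Fin k → R} {S : Fin m → Fin k → R} (hS : Generates r S) (v : Fin k → I)
    (hv : ∀ l, ∑ i, S l i • v i = 0) : ∃ w : I, ∀ i, v i = r i • w := by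
  let ρ : (Fin k → R) →ₗ[R] R := Fintype.linearCombination R r
  let φ : (Fin k → R) →ₗ[R] I := Fintype.linearCombination R v
  have hφ : ∀ x, ρ.rangeRestrict x = 0 → φ x = 0 := by
    intro x hx
    have h1 : ρ x = 0 := congrArg Subtype.val hx
    have h2 := hS.2 x (by
      simpa [ρ, Fintype.linearCombination_apply, mul_comm] using h1)
    refine (Submodule.span_le.mpr ?_ : _ ≤ LinearMap.ker φ) h2
    rintro _ ⟨l, rfl⟩
    rw [SetLike.mem_coe, LinearMap.mem_ker, ← hv l, Fintype.linearCombination_apply]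
  obtain ⟨g, hg⟩ := exists_desc ρ.rangeRestrict ρ.surjective_rangeRestrict φ hφ
  obtain ⟨h, hh⟩ := Module.Injective.out (LinearMap.range ρ).subtype Subtype.val_injective g
  refine ⟨h 1, fun i ↦ ?_⟩
  have h1 := hh (ρ.rangeRestrict (Pi.single i 1))
  rw [hg] at h1
  have h2 : φ (Pi.single i 1) = v i := by simp [φ]
  have h3 : (LinearMap.range ρ).subtype (ρ.rangeRestrict (Pi.single i 1)) = r i • 1 := by
    simp [ρ]
  rw [← h2, ← h1, h3, map_smul]

theorem flat_characterModule [IsNoetherianRing R] (I : Type u) [AddCommGroup I] [Module R I]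
    [Module.Injective R I] : Module.Flat R (CharacterModule I) := by
  refine flat_of_generates fun k r ↦ ?_
  obtain ⟨m, S, hS⟩ := exists_generates r
  refine ⟨m, S, hS, fun x hx ↦ ?_⟩
  let σ : (Fin k → I) →ₗ[R] (Fin m → I) :=
    LinearMap.pi fun l ↦ ∑ i, S l i • LinearMap.proj i
  have hσ (v l) : σ v l = ∑ i, S l i • v i := by simp [σ]
  let X : CharacterModule (Fin k → I) :=
    ∑ i, CharacterModule.dual (R := R) (LinearMap.proj (φ := fun _ ↦ I) i) (x i)
  have hX (v) : X v = ∑ i, x i (v i) := characterModule_sum_apply _ _ _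
  obtain ⟨Y, hY⟩ := exists_character_comp_eq σ X fun v hv ↦ by
    obtain ⟨w, hw⟩ := exists_eq_smul_of_injective hS v fun l ↦ by rw [← hσ, hv]; rfl
    rw [hX]
    have := DFunLike.congr_fun hx w
    rw [characterModule_sum_apply] at this
    simp only [hw]
    exact this
  refine ⟨fun l ↦ CharacterModule.dual (R := R) (LinearMap.single R (fun _ ↦ I) l) Y, fun i ↦
    CharacterModule.ext _ fun a ↦ ?_⟩
  have h1 := hY (Pi.single i a)
  have h2 : X (Pi.single i a) = x i a := by
    rw [hX, Finset.sum_eq_single i]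
    · simp
    · intro j _ hj
      simp [Pi.single_eq_of_ne hj]
    · simp
  rw [← h2, ← h1, characterModule_sum_apply, ← Finset.univ_sum_single (σ (Pi.single i a)), map_sum]
  refine Finset.sum_congr rfl fun l _ ↦ ?_
  change Y (Pi.single l _) = Y (Pi.single l (S l i • a))
  rw [hσ, Finset.sum_eq_single i]
  · simp
  · intro j _ hj
    simp [Pi.single_eq_of_ne hj]
  · simp

variable (R) in
/-- The cokernel of the canonical map to the double character module. -/
abbrev BidualQuotient (M : Type u) [AddCommGroup M] [Module R M] : Type u :=
  CharacterModule (CharacterModule M) ⧸ LinearMap.range (evalCharacter R M)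

lemma exists_lift_bidualQuotient [IsNoetherianRing R] {M : Type u} [AddCommGroup M] [Module R M]
    {N : Type u} [AddCommGroup N] [Module R N] [Module.Finite R N]
    (φ : N →ₗ[R] BidualQuotient R M) :
    ∃ ψ : N →ₗ[R] CharacterModule (CharacterModule M),
      (LinearMap.range (evalCharacter R M)).mkQ ∘ₗ ψ = φ := by
  obtain ⟨k, π, hπ⟩ := Module.Finite.exists_fin' R N
  obtain ⟨m, S, hS⟩ := Submodule.fg_iff_exists_fin_generating_family.mp
    (IsNoetherian.noetherian (LinearMap.ker π))
  choose z hz using fun i ↦ Submodule.mkQ_surjective _ (φ (π (Pi.single i 1)))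
  have hz' (v : Fin k → R) : Submodule.mkQ _ (∑ i, v i • z i) = φ (π v) := by
    rw [map_sum]
    simp_rw [map_smul, hz, ← map_smul, ← map_sum]
    congr 2
    simp [← Pi.single_smul, Finset.univ_sum_single]
  have hSz (l : Fin m) : ∃ a, evalCharacter R M a = ∑ i, S l i • z i := by
    have h1 : S l ∈ LinearMap.ker π := hS ▸ Submodule.subset_span (Set.mem_range_self l)
    have h2 := hz' (S l)
    rw [LinearMap.mem_ker.mp h1, map_zero] at h2
    exact (Submodule.Quotient.mk_eq_zero _).mp h2
  choose a ha using hSz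
  let σ : (Fin k → M) →ₗ[R] (Fin m → M) :=
    LinearMap.pi fun l ↦ ∑ i, S l i • LinearMap.proj i
  have hσ (v l) : σ v l = ∑ i, S l i • v i := by simp [σ]
  obtain ⟨b, hb⟩ : a ∈ LinearMap.range σ := by
    refine mem_of_forall_character _ _ fun χ hχ ↦ ?_
    let χ' (l : Fin m) : CharacterModule M :=
      CharacterModule.dual (R := R) (LinearMap.single R (fun _ ↦ M) l) χ
    have hχ' (i : Fin k) : ∑ l, S l i • χ' l = 0 := by
      refine CharacterModule.ext _ fun x ↦ ?_
      have h1 := hχ _ (LinearMap.mem_range_self σ (Pi.single i x))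
      rw [← Finset.univ_sum_single (σ (Pi.single i x)), map_sum] at h1
      rw [characterModule_sum_apply]
      refine Eq.trans (Finset.sum_congr rfl fun l _ ↦ ?_) h1
      change χ (Pi.single l (S l i • x)) = _
      rw [hσ, Finset.sum_eq_single i]
      · simp
      · intro j _ hj
        simp [Pi.single_eq_of_ne hj]
      · simp
    have h2 : χ a = ∑ l, evalCharacter R M (a l) (χ' l) := by
      conv_lhs => rw [← Finset.univ_sum_single a, map_sum]
      rfl
    have h3 (l) : evalCharacter R M (a l) (χ' l) = ∑ i, z i (S l i • χ' l) := by
      rw [ha, characterModule_sum_apply]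
      rfl
    rw [h2, Finset.sum_congr rfl fun l _ ↦ h3 l, Finset.sum_comm]
    refine Finset.sum_eq_zero fun i _ ↦ ?_
    rw [← map_sum, hχ', map_zero]
  let ψ₀ : (Fin k → R) →ₗ[R] CharacterModule (CharacterModule M) :=
    Fintype.linearCombination R fun i ↦ z i - evalCharacter R M (b i)
  have hψ₀ (v) : ψ₀ v = ∑ i, v i • z i - evalCharacter R M (∑ i, v i • b i) := by
    simp [ψ₀, Fintype.linearCombination_apply, smul_sub, Finset.sum_sub_distrib]
  obtain ⟨ψ, hψ⟩ := exists_desc π hπ ψ₀ fun v hv ↦ by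
    have h1 : v ∈ Submodule.span R (Set.range S) := hS ▸ hv
    refine (Submodule.span_le.mpr ?_ : _ ≤ LinearMap.ker ψ₀) h1
    rintro _ ⟨l, rfl⟩
    rw [SetLike.mem_coe, LinearMap.mem_ker, hψ₀, ← ha, ← hσ, hb, sub_self]
  refine ⟨ψ, LinearMap.ext fun n ↦ ?_⟩
  obtain ⟨v, rfl⟩ := hπ n
  rw [LinearMap.comp_apply, hψ, hψ₀, map_sub, hz', sub_eq_self]
  exact (Submodule.Quotient.mk_eq_zero _).mpr (LinearMap.mem_range_self _ _)

lemma HomAcyclic.character_bidualQuotient {M : Type u} [AddCommGroup M] [Module R M]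
    (h : HomAcyclic (R := R) (CharacterModule (CharacterModule (CharacterModule M)))) :
    HomAcyclic (R := R) (CharacterModule (BidualQuotient R M)) := by
  let ev := evalCharacter R M
  let q := CharacterModule.dual (LinearMap.range ev).mkQ
  have hq : Function.Injective q :=
    CharacterModule.dual_injective_of_surjective _ (Submodule.mkQ_surjective _)
  let e := LinearEquiv.ofInjective q hq
  let θ : CharacterModule (CharacterModule (CharacterModule M)) →ₗ[R]
      CharacterModule (CharacterModule (CharacterModule M)) :=
    LinearMap.id - evalCharacter R (CharacterModule M) ∘ₗ CharacterModule.dual ev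
  have hθ (χ) : θ χ ∈ LinearMap.range q := by
    obtain ⟨ψ, hψ⟩ := exists_character_comp_eq (LinearMap.range ev).mkQ (θ χ) (by
      intro z hz
      obtain ⟨x, rfl⟩ := (Submodule.Quotient.mk_eq_zero _).mp hz
      exact sub_self (χ (ev x)))
    exact ⟨ψ, CharacterModule.ext _ hψ⟩
  refine h.of_retract q (e.symm.toLinearMap ∘ₗ θ.codRestrict (LinearMap.range q) hθ) fun χ ↦ ?_
  rw [LinearMap.comp_apply, LinearEquiv.coe_coe, LinearEquiv.symm_apply_eq]
  refine Subtype.ext (CharacterModule.ext _ fun z ↦ ?_)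
  change q χ z - z (CharacterModule.dual ev (q χ)) = q χ z
  have : CharacterModule.dual ev (q χ) = 0 := CharacterModule.ext _ fun x ↦ by
    change χ ((LinearMap.range ev).mkQ (ev x)) = 0
    rw [Submodule.mkQ_apply, (Submodule.Quotient.mk_eq_zero _).mpr (LinearMap.mem_range_self _ _),
      map_zero]
  rw [this, map_zero, sub_zero]

end Characters

section BidualCoresolution

variable (R) in
/-- The iterated bidual quotients of a module. -/
def bidualTower (M : Type u) [AddCommGroup M] [Module R M] : ℕ → ModuleCat.{u} R
  | 0 => ModuleCat.of R M
  | k + 1 => ModuleCat.of R (BidualQuotient R (bidualTower M k))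

variable (R) in
/-- The terms of the pure coresolution of a module by double character modules. -/
def bidualCoresolution (M : Type u) [AddCommGroup M] [Module R M] : ℕ → ModuleCat.{u} R
  | 0 => ModuleCat.of R PUnit
  | 1 => ModuleCat.of R M
  | k + 2 => ModuleCat.of R (CharacterModule (CharacterModule (bidualTower R M k)))

variable (R) in
/-- The differentials of the pure coresolution of a module by double character modules. -/
def bidualCoresolutionD (M : Type u) [AddCommGroup M] [Module R M] :
    ∀ n, bidualCoresolution R M n →ₗ[R] bidualCoresolution R M (n + 1)
  | 0 => 0
  | 1 => evalCharacter R M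
  | k + 2 => evalCharacter R (BidualQuotient R (bidualTower R M k)) ∘ₗ
      (LinearMap.range (evalCharacter R (bidualTower R M k))).mkQ

variable {M : Type u} [AddCommGroup M] [Module R M]

lemma bidualCoresolutionD_comp (n : ℕ) :
    bidualCoresolutionD R M (n + 1) ∘ₗ bidualCoresolutionD R M n = 0 := by
  have key (N : Type u) [AddCommGroup N] [Module R N] (x : N) :
      (LinearMap.range (evalCharacter R N)).mkQ (evalCharacter R N x) = 0 :=
    (Submodule.Quotient.mk_eq_zero _).mpr (LinearMap.mem_range_self _ _)
  have key' (N : Type u) [AddCommGroup N] [Module R N] (x : N) :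
      evalCharacter R _ ((LinearMap.range (evalCharacter R N)).mkQ (evalCharacter R N x)) = 0 := by
    rw [key, map_zero]
  refine LinearMap.ext fun x ↦ ?_
  match n with
  | 0 => exact map_zero (evalCharacter R M)
  | 1 => exact key' M x
  | k + 2 => exact key' (BidualQuotient R (bidualTower R M k)) _

lemma exists_evalCharacter_comp_eq {N M : Type u} [AddCommGroup N] [Module R N] [AddCommGroup M]
    [Module R M] (φ : N →ₗ[R] CharacterModule (CharacterModule M))
    (hφ : ∀ x, evalCharacter R _ ((LinearMap.range (evalCharacter R M)).mkQ (φ x)) = 0) :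
    ∃ φ' : N →ₗ[R] M, ∀ x, evalCharacter R M (φ' x) = φ x := by
  have h (x : N) : φ x ∈ LinearMap.range (evalCharacter R M) := by
    rw [← Submodule.Quotient.mk_eq_zero]
    exact evalCharacter_injective R _ ((hφ x).trans (map_zero _).symm)
  let e := LinearEquiv.ofInjective _ (evalCharacter_injective R M)
  exact ⟨e.symm.toLinearMap ∘ₗ φ.codRestrict _ h,
    fun x ↦ congrArg Subtype.val (e.apply_symm_apply (φ.codRestrict _ h x))⟩

lemma pureExact_bidualCoresolution [IsNoetherianRing R] :
    PureExact (bidualCoresolutionD R M) := by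
  intro n N _ _ _ φ hφ
  match n, φ, hφ with
  | 0, φ, hφ =>
    refine ⟨0, LinearMap.ext fun x ↦ evalCharacter_injective R M ?_⟩
    exact (map_zero _).trans (LinearMap.congr_fun hφ x).symm
  | n + 1, φ, hφ =>
    obtain ⟨φ', hφ'⟩ := exists_evalCharacter_comp_eq (M := bidualTower R M n) φ
      fun x ↦ LinearMap.congr_fun hφ x
    match n, φ, φ', hφ' with
    | 0, φ, φ', hφ' => exact ⟨φ', LinearMap.ext hφ'⟩
    | k + 1, φ, φ', hφ' =>
      obtain ⟨ψ, hψ⟩ := exists_lift_bidualQuotient φ'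
      refine ⟨ψ, LinearMap.ext fun x ↦ (hφ' x).symm.trans ?_ |>.symm⟩
      exact congrArg _ (LinearMap.congr_fun hψ x).symm

theorem HomAcyclic.of_character [IsNoetherianRing R]
    (H : ∀ (N : Type u) [AddCommGroup N] [Module R N], HomAcyclic (R := R) (CharacterModule N) →
      HomAcyclic (R := R) (CharacterModule (CharacterModule N)))
    (hM : HomAcyclic (R := R) (CharacterModule M)) : HomAcyclic (R := R) M := by
  have htower (n : ℕ) : HomAcyclic (R := R) (CharacterModule (bidualTower R M n)) := by
    induction n with
    | zero => exact hM
    | succ n ih => exact HomAcyclic.character_bidualQuotient (H _ (H _ ih))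
  intro C hC i j k hi hk f hf
  obtain ⟨i, rfl⟩ : ∃ i' : ℤ, i = i' - (0 : ℕ) := ⟨i, by simp⟩
  obtain rfl : j = i - ((0 + 1 : ℕ) : ℤ) := by push_cast; omega
  obtain rfl : k = i - ((0 + 1 + 1 : ℕ) : ℤ) := by push_cast; omega
  let dP (n : ℕ) := dl C (i - n) (i - (n + 1 : ℕ))
  let dY := bidualCoresolutionD R M
  let T (n : ℕ) := {p : C.X (i - (n + 1 : ℕ)) →ₗ[R] bidualCoresolution R M (n + 1) //
    ∀ x, dY (n + 1) (p (dP n x)) = 0}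
  have step (n : ℕ) (p : T n) : ∃ q : T (n + 1), ∀ x, q.1 (dP (n + 1) x) = dY (n + 1) (p.1 x) := by
    obtain ⟨q, hq⟩ := H _ (htower n) C hC (i - n) _ (i - (n + 1 + 1 : ℕ))
      (by push_cast; omega) (by push_cast; omega) (dY (n + 1) ∘ₗ p.1) p.2
    refine ⟨⟨q, fun x ↦ ?_⟩, fun x ↦ (hq x).symm⟩
    exact (congrArg _ (hq x).symm).trans
      (LinearMap.congr_fun (bidualCoresolutionD_comp (n + 1)) (p.1 x))
  choose next hnext using step
  let G : ∀ n, T n := Nat.rec ⟨f, fun x ↦ (congrArg _ (hf x)).trans (map_zero _)⟩ next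
  let F : ∀ n : ℕ, C.X (i - n) →ₗ[R] bidualCoresolution R M n
    | 0 => 0
    | n + 1 => (G n).1
  have (n : ℕ) : Module.Projective R (C.X (i - n)) := hC.module_projective _
  have : Subsingleton (bidualCoresolution R M 0) := inferInstanceAs (Subsingleton PUnit)
  obtain ⟨s, hs⟩ := PureExact.exists_homotopy (P := fun n : ℕ ↦ C.X (i - n)) (dP := dP)
    pureExact_bidualCoresolution
    (fun n ↦ LinearMap.ext fun x ↦ dl_dl C _ _ _ x) bidualCoresolutionD_comp F (fun n ↦ by
      refine LinearMap.ext fun x ↦ ?_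
      cases n with
      | zero => exact hf x
      | succ n => exact hnext n (G n) x)
  refine ⟨s 1, fun x ↦ ?_⟩
  exact (LinearMap.congr_fun (hs 0) x).trans (add_zero _)

end BidualCoresolution

section ExtVanishing

lemma subsingleton_homology_iff {C : CochainComplex (ModuleCat.{u} R) ℕ} (i j k : ℕ)
    (hi : i + 1 = j) (hk : j + 1 = k) : Subsingleton (C.homology j) ↔
      ∀ x, (C.d j k).hom x = 0 → ∃ y, (C.d i j).hom y = x := by
  rw [← ModuleCat.isZero_iff_subsingleton, ← HomologicalComplex.exactAt_iff_isZero_homology,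
    HomologicalComplex.exactAt_iff' C i j k ((ComplexShape.up ℕ).prev_eq' hi)
      ((ComplexShape.up ℕ).next_eq' hk), ShortComplex.moduleCat_exact_iff]
  rfl

lemma extVanish_one_iff_of_resolution {Q : ModuleCat.{u} R} (P : ProjectiveResolution Q)
    (N : ModuleCat.{u} R) : extVanish 1 Q N ↔
      ∀ f : P.complex.X 1 ⟶ N, P.complex.d 2 1 ≫ f = 0 →
        ∃ g : P.complex.X 0 ⟶ N, P.complex.d 1 0 ≫ g = f :=
  (P.isoExt (R := R) 1 N).toLinearEquiv.toEquiv.subsingleton_congr.trans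
    (subsingleton_homology_iff 0 1 2 rfl rfl)

lemma exists_extension_of_presentation {L L' Q N : Type u} [AddCommGroup L] [Module R L]
    [Module.Projective R L] [AddCommGroup L'] [Module R L'] [Module.Projective R L']
    [AddCommGroup Q] [Module R Q] [AddCommGroup N] [Module R N]
    (π : L →ₗ[R] Q) (hπ : Function.Surjective π) (π' : L' →ₗ[R] Q) (hπ' : Function.Surjective π')
    (h : ∀ f : LinearMap.ker π →ₗ[R] N, ∃ g : L →ₗ[R] N, ∀ x : LinearMap.ker π, g x = f x)
    (f : LinearMap.ker π' →ₗ[R] N) : ∃ g : L' →ₗ[R] N, ∀ x : LinearMap.ker π', g x = f x := by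
  obtain ⟨α, hα⟩ := Module.projective_lifting_property π' π hπ'
  obtain ⟨β, hβ⟩ := Module.projective_lifting_property π π' hπ
  replace hα (x) : π' (α x) = π x := LinearMap.congr_fun hα x
  replace hβ (x) : π (β x) = π' x := LinearMap.congr_fun hβ x
  obtain ⟨g, hg⟩ := h (f ∘ₗ (α ∘ₗ (LinearMap.ker π).subtype).codRestrict (LinearMap.ker π')
    fun x ↦ (hα x).trans x.2)
  let δ : L' →ₗ[R] LinearMap.ker π' := (α ∘ₗ β - LinearMap.id).codRestrict _ fun x ↦ by
    simp [hα, hβ]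
  refine ⟨g ∘ₗ β - f ∘ₗ δ, fun x ↦ ?_⟩
  have h1 := hg ⟨β x, (hβ x).trans x.2⟩
  change g (β x) - f (δ x) = f x
  rw [h1, LinearMap.comp_apply, ← map_sub]
  congr 1
  refine Subtype.ext ?_
  change α (β x) - (α (β x) - x) = x
  abel

theorem extVanish_one_iff {L : Type u} [AddCommGroup L] [Module R L] [Module.Projective R L]
    {Q : ModuleCat.{u} R} (π : L →ₗ[R] Q) (hπ : Function.Surjective π) (N : ModuleCat.{u} R) :
    extVanish 1 Q N ↔
      ∀ f : LinearMap.ker π →ₗ[R] N, ∃ g : L →ₗ[R] N, ∀ x : LinearMap.ker π, g x = f x := by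
  let P := projectiveResolution Q
  have (i : ℕ) : Module.Projective R (P.complex.X i) :=
    (IsProjective.iff_projective _).mpr (P.projective i)
  let e : ((ChainComplex.single₀ (ModuleCat.{u} R)).obj Q).X 0 ≅ Q := Iso.refl _
  let π' : P.complex.X 0 →ₗ[R] Q := (P.π.f 0 ≫ e.hom).hom
  have hπ' : Function.Surjective π' := (ModuleCat.epi_iff_surjective _).mp inferInstance
  let d := (P.complex.d 1 0).hom
  have hd (x) : π' (d x) = 0 :=
    LinearMap.congr_fun (congrArg ModuleCat.Hom.hom P.complex_d_comp_π_f_zero) x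
  have hex (x) (hx : π' x = 0) : ∃ y, d y = x :=
    (ShortComplex.moduleCat_exact_iff _).mp P.exact₀ x hx
  have hex' (x) (hx : d x = 0) : ∃ y, (P.complex.d 2 1).hom y = x :=
    (ShortComplex.moduleCat_exact_iff _).mp (P.exact_succ 0) x hx
  have hdd (x) : d ((P.complex.d 2 1).hom x) = 0 :=
    LinearMap.congr_fun (congrArg ModuleCat.Hom.hom (P.complex.d_comp_d 2 1 0)) x
  let d' := d.codRestrict (LinearMap.ker π') hd
  have hd' : Function.Surjective d' := fun x ↦ by
    obtain ⟨y, hy⟩ := hex x x.2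
    exact ⟨y, Subtype.ext hy⟩
  have key : extVanish 1 Q N ↔
      ∀ f : LinearMap.ker π' →ₗ[R] N, ∃ g : P.complex.X 0 →ₗ[R] N,
        ∀ x : LinearMap.ker π', g x = f x := by
    rw [extVanish_one_iff_of_resolution P]
    refine ⟨fun h f ↦ ?_, fun h f hf ↦ ?_⟩
    · obtain ⟨g, hg⟩ := h (ModuleCat.ofHom (f ∘ₗ d')) (by
        ext x
        exact (congrArg f (Subtype.ext (hdd x) : d' _ = 0)).trans (map_zero f))
      refine ⟨g.hom, fun x ↦ ?_⟩
      obtain ⟨y, rfl⟩ := hd' x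
      exact LinearMap.congr_fun (congrArg ModuleCat.Hom.hom hg) y
    · obtain ⟨f', hf'⟩ := exists_desc d' hd' f.hom fun x hx ↦ by
        obtain ⟨y, rfl⟩ := hex' x (congrArg Subtype.val hx)
        exact LinearMap.congr_fun (congrArg ModuleCat.Hom.hom hf) y
      obtain ⟨g, hg⟩ := h f'
      refine ⟨ModuleCat.ofHom g, ?_⟩
      ext x
      exact (hg (d' x)).trans (hf' x)
  rw [key]
  exact ⟨fun h f ↦ exists_extension_of_presentation π' hπ' π hπ h f,
    fun h f ↦ exists_extension_of_presentation π hπ π' hπ' h f⟩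

end ExtVanishing

section GorensteinModules

variable {C : ChainComplex (ModuleCat.{u} R) ℤ}

/-- The translate of a complex by an integer. -/
def translate (C : ChainComplex (ModuleCat.{u} R) ℤ) (n : ℤ) : ChainComplex (ModuleCat.{u} R) ℤ where
  X i := C.X (i + n)
  d i j := C.d (i + n) (j + n)
  shape i j hij := C.shape _ _ fun h ↦ hij (by
    change j + 1 = i
    change j + n + 1 = i + n at h
    omega)
  d_comp_d' i j k _ _ := C.d_comp_d _ _ _

lemma IsTotallyAcyclic.translate (hC : IsTotallyAcyclic C) (n : ℤ) :
    IsTotallyAcyclic (translate C n) where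
  projective i := hC.projective _
  exactAt i := exactAt_of_exists_eq (k := i - 1) rfl (by omega) fun x hx ↦
    exists_eq_of_exactAt (C := C) (i := i + 1 + n) (j := i + n) (k := i - 1 + n)
      (hC.exactAt _) (by omega) (by omega) x hx
  exists_lift P hP i f hf := by
    have : Module.Projective R P := (IsProjective.iff_projective _).mpr hP
    obtain ⟨g, hg⟩ := HomAcyclic.of_projective (P : Type u) C hC (i + 1 + n) (i + n) (i - 1 + n)
      (by omega) (by omega) f.hom fun x ↦ LinearMap.congr_fun (congrArg ModuleCat.Hom.hom hf) x
    exact ⟨ModuleCat.ofHom g, ModuleCat.hom_ext (LinearMap.ext hg)⟩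

lemma IsTotallyAcyclic.isGorensteinProjective (hC : IsTotallyAcyclic C) {i j : ℤ} (hi : j + 1 = i) :
    IsGorensteinProjective (ModuleCat.of R (C.X j ⧸ LinearMap.range (dl C i j))) := by
  obtain ⟨n, rfl⟩ : ∃ n, j = 0 + n := ⟨j, by omega⟩
  obtain rfl : i = 1 + n := by omega
  exact ⟨VirtuallyGorenstein.translate C n, (hC.translate n).projective, (hC.translate n).exactAt,
    ⟨(ModuleCat.cokernelIsoRangeQuotient (C.d (1 + n) (0 + n))).symm⟩, (hC.translate n).exists_lift⟩

lemma exists_presentation_of_isGorensteinProjective {Q : ModuleCat.{u} R}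
    (hQ : IsGorensteinProjective Q) :
    ∃ C : ChainComplex (ModuleCat.{u} R) ℤ, IsTotallyAcyclic C ∧
      ∃ π : C.X 0 →ₗ[R] Q, Function.Surjective π ∧
        LinearMap.ker π = LinearMap.range (dl C 1 0) := by
  obtain ⟨C, h1, h2, ⟨e⟩, h3⟩ := hQ
  let e' := (e ≪≫ ModuleCat.cokernelIsoRangeQuotient (C.d 1 0)).symm.toLinearEquiv
  refine ⟨C, ⟨h1, h2, h3⟩, e'.toLinearMap ∘ₗ (LinearMap.range (dl C 1 0)).mkQ,
    e'.surjective.comp (Submodule.mkQ_surjective _), ?_⟩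
  rw [LinearEquiv.ker_comp, Submodule.ker_mkQ]

lemma memGPperp_of_homAcyclic {N : ModuleCat.{u} R} (hN : HomAcyclic (R := R) N) :
    MemGPperp N := by
  intro Q hQ
  obtain ⟨C, hC, π, hπ, hker⟩ := exists_presentation_of_isGorensteinProjective hQ
  have := hC.module_projective 0
  refine (extVanish_one_iff π hπ N).mpr fun f ↦ ?_
  let d' := (dl C 1 0).codRestrict (LinearMap.ker π) fun x ↦
    hker ▸ LinearMap.mem_range_self (dl C 1 0) x
  obtain ⟨g, hg⟩ := hN C hC 2 1 0 (by norm_num) (by norm_num) (f ∘ₗ d') fun x ↦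
    (congrArg f (Subtype.ext (dl_dl C 2 1 0 x) : d' _ = 0)).trans (map_zero f)
  refine ⟨g, fun x ↦ ?_⟩
  obtain ⟨y, hy⟩ : (x : C.X 0) ∈ LinearMap.range (dl C 1 0) := hker ▸ x.2
  obtain rfl : d' y = x := Subtype.ext hy
  exact (hg y).symm

lemma homAcyclic_of_memGPperp {N : ModuleCat.{u} R} (hN : MemGPperp N) :
    HomAcyclic (R := R) N := by
  intro C hC i j k hi hk f hf
  have := hC.module_projective k
  obtain ⟨f', hf'⟩ := exists_desc (dl C j k).rangeRestrict (dl C j k).surjective_rangeRestrict f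
    fun x hx ↦ by
      obtain ⟨y, rfl⟩ := exists_eq_of_exactAt (hC.exactAt j) hi hk x (congrArg Subtype.val hx)
      exact hf y
  have hker : LinearMap.ker (LinearMap.range (dl C j k)).mkQ = LinearMap.range (dl C j k) :=
    Submodule.ker_mkQ _
  obtain ⟨g, hg⟩ := (extVanish_one_iff (Q := ModuleCat.of R (C.X k ⧸ LinearMap.range (dl C j k)))
    (LinearMap.range (dl C j k)).mkQ (Submodule.mkQ_surjective _) N).mp
    (hN _ (hC.isGorensteinProjective hk)) (f' ∘ₗ (LinearEquiv.ofEq _ _ hker).toLinearMap)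
  refine ⟨g, fun x ↦ (hf' x).symm.trans ?_⟩
  exact (hg ⟨dl C j k x, hker.ge (LinearMap.mem_range_self (dl C j k) x)⟩).symm

lemma memPerpGI_of_homAcyclic
    (h : ∀ E : ModuleCat.{u} R, IsGorensteinInjective E → GPPureInjective E)
    {M : ModuleCat.{u} R} (hM : HomAcyclic (R := R) M) : MemPerpGI M := by
  intro E hE
  refine (extVanish_one_iff (freeCover (R := R) M) (freeCover_surjective _) E).mpr fun f ↦ ?_
  let S : ShortComplex (ModuleCat.{u} R) :=
    ShortComplex.mk (X₁ := ModuleCat.of R (LinearMap.ker (freeCover (R := R) M)))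
      (X₂ := ModuleCat.of R (M →₀ R)) (X₃ := M)
      (ModuleCat.ofHom (LinearMap.ker (freeCover (R := R) M)).subtype)
      (ModuleCat.ofHom (freeCover (R := R) M))
      (ModuleCat.hom_ext (LinearMap.ext fun x ↦ x.2))
  have hS : S.ShortExact :=
    { exact := (ShortComplex.moduleCat_exact_iff _).mpr fun x hx ↦ ⟨⟨x, hx⟩, rfl⟩
      mono_f := (ModuleCat.mono_iff_injective _).mpr Subtype.val_injective
      epi_g := (ModuleCat.epi_iff_surjective _).mpr (freeCover_surjective _) }
  have hpure : GPPureExact S := by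
    intro Q hQ φ
    obtain ⟨C, hC, π, hπ, hker⟩ := exists_presentation_of_isGorensteinProjective hQ
    have hπd (x) : π (dl C 1 0 x) = 0 :=
      LinearMap.mem_ker.mp (hker ▸ LinearMap.mem_range_self (dl C 1 0) x)
    obtain ⟨g, hg⟩ := hM C hC 1 0 (-1) (by norm_num) (by norm_num) (φ.hom ∘ₗ π) fun x ↦ by
      rw [LinearMap.comp_apply, hπd, map_zero]
    have := hC.module_projective (-1)
    obtain ⟨g', hg'⟩ := Module.projective_lifting_property (freeCover (R := R) M) g
      (freeCover_surjective _)
    obtain ⟨ψ, hψ⟩ := exists_desc π hπ (g' ∘ₗ dl C 0 (-1)) fun x hx ↦ by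
      obtain ⟨y, rfl⟩ : x ∈ LinearMap.range (dl C 1 0) := hker ▸ hx
      rw [LinearMap.comp_apply, dl_dl, map_zero]
    refine ⟨ModuleCat.ofHom ψ, ModuleCat.hom_ext (LinearMap.ext fun q ↦ ?_)⟩
    obtain ⟨x, rfl⟩ := hπ q
    exact (congrArg (freeCover (R := R) M) (hψ x)).trans ((LinearMap.congr_fun hg' _).trans (hg x).symm)
  obtain ⟨g, hg⟩ := h E hE S hS hpure (ModuleCat.ofHom f)
  exact ⟨g.hom, fun x ↦ LinearMap.congr_fun (congrArg ModuleCat.Hom.hom hg) x⟩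

/-- The cochain complex of character modules of a chain complex. -/
def characterComplex (C : ChainComplex (ModuleCat.{u} R) ℤ) :
    CochainComplex (ModuleCat.{u} R) ℤ where
  X i := ModuleCat.of R (CharacterModule (C.X i))
  d i j := ModuleCat.ofHom (CharacterModule.dual (dl C j i))
  shape i j hij := by
    rw [dl, C.shape _ _ hij]
    exact ModuleCat.hom_ext (LinearMap.ext fun χ ↦ CharacterModule.ext _ fun x ↦ map_zero χ)
  d_comp_d' i j k _ _ := ModuleCat.hom_ext (LinearMap.ext fun χ ↦ CharacterModule.ext _ fun x ↦
    (congrArg χ (dl_dl C k j i x)).trans (map_zero χ))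

lemma exists_dual_eq_of_exactAt {i j k : ℤ} (hC : C.ExactAt j) (hi : j + 1 = i) (hk : k + 1 = j)
    (χ : CharacterModule (C.X j)) (hχ : CharacterModule.dual (dl C i j) χ = 0) :
    ∃ ψ, CharacterModule.dual (dl C j k) ψ = χ := by
  obtain ⟨ψ, hψ⟩ := exists_character_comp_eq (dl C j k) χ fun x hx ↦ by
    obtain ⟨y, rfl⟩ := exists_eq_of_exactAt hC hi hk x hx
    exact DFunLike.congr_fun hχ y
  exact ⟨ψ, CharacterModule.ext _ hψ⟩

/-- Exchange of the variables of a character-valued linear map. -/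
def swapCharacter {A B : Type*} [AddCommGroup A] [Module R A] [AddCommGroup B] [Module R B]
    (f : A →ₗ[R] CharacterModule B) : B →ₗ[R] CharacterModule A :=
  CharacterModule.dual f ∘ₗ evalCharacter R B

variable [IsNoetherianRing R]

lemma IsTotallyAcyclic.isGorensteinInjective (hdim : ringKrullDim R < ⊤)
    (hC : IsTotallyAcyclic C) {i j : ℤ} (hi : j + 1 = i) :
    IsGorensteinInjective (ModuleCat.of R (LinearMap.ker (CharacterModule.dual (dl C i j)))) := by
  wlog hj : j = 0 generalizing C i j
  · obtain ⟨n, rfl⟩ : ∃ n, j = 0 + n := ⟨j, by omega⟩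
    obtain rfl : i = 1 + n := by omega
    exact this (hC.translate n) (i := 1) (j := 0) rfl rfl
  subst hj
  obtain rfl : i = 1 := by omega
  refine ⟨characterComplex C, fun i ↦ ?_, fun i ↦ ?_,
    ⟨(ModuleCat.kernelIsoKer ((characterComplex C).d 0 1)).symm⟩, fun I hI i f hf ↦ ?_⟩
  · have := hC.module_projective i
    have : Module.Injective R (CharacterModule (C.X i)) :=
      Module.Flat.iff_characterModule_injective.mp inferInstance
    exact Module.injective_object_of_injective_module R (CharacterModule (C.X i))
  · rw [HomologicalComplex.exactAt_iff' _ (i - 1) i (i + 1)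
      ((ComplexShape.up ℤ).prev_eq' (by simp)) ((ComplexShape.up ℤ).next_eq' rfl),
      ShortComplex.moduleCat_exact_iff]
    exact exists_dual_eq_of_exactAt (hC.exactAt i) rfl (by omega)
  · have : Module.Injective R I := Module.injective_module_of_injective_object R I
    have := flat_characterModule (R := R) I
    obtain ⟨g, hg⟩ := HomAcyclic.of_flat hdim (CharacterModule I) C hC (i + 1) i (i - 1) rfl
      (by omega) (swapCharacter f.hom) fun x ↦ CharacterModule.ext _ fun a ↦
        congrArg (fun φ : I →ₗ[R] CharacterModule (C.X (i + 1)) ↦ φ a x)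
          (congrArg ModuleCat.Hom.hom hf)
    exact ⟨ModuleCat.ofHom (swapCharacter g), ModuleCat.hom_ext (LinearMap.ext fun a ↦
      CharacterModule.ext _ fun x ↦ DFunLike.congr_fun (hg x) a)⟩

lemma homAcyclic_characterModule_of_memPerpGI (hdim : ringKrullDim R < ⊤) {M : ModuleCat.{u} R}
    (hM : MemPerpGI M) : HomAcyclic (R := R) (CharacterModule M) := by
  intro C hC i j k hi hk f hf
  let δ := CharacterModule.dual (dl C j k)
  have hlift (x : M →₀ R) : swapCharacter f (freeCover M x) ∈ LinearMap.range δ :=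
    exists_dual_eq_of_exactAt (hC.exactAt j) hi hk _ (CharacterModule.ext _ fun y ↦
      DFunLike.congr_fun (hf y) (freeCover M x))
  obtain ⟨t, ht⟩ := Module.projective_lifting_property δ.rangeRestrict
    ((swapCharacter f ∘ₗ freeCover M).codRestrict _ hlift) δ.surjective_rangeRestrict
  replace ht (x) : δ (t x) = swapCharacter f (freeCover M x) :=
    congrArg Subtype.val (LinearMap.congr_fun ht x)
  obtain ⟨g, hg⟩ := (extVanish_one_iff (freeCover (R := R) M) (freeCover_surjective _) _).mp
    (hM _ (hC.isGorensteinInjective hdim hk))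
    ((t ∘ₗ (LinearMap.ker (freeCover (R := R) M)).subtype).codRestrict (LinearMap.ker δ)
      fun x ↦ (ht x).trans ((congrArg _ x.2).trans (map_zero _)))
  obtain ⟨v, hv⟩ := exists_desc (freeCover (R := R) M) (freeCover_surjective _)
    (t - (LinearMap.ker δ).subtype ∘ₗ g) fun x hx ↦
      sub_eq_zero.mpr (congrArg Subtype.val (hg ⟨x, hx⟩)).symm
  refine ⟨swapCharacter v, fun x ↦ CharacterModule.ext _ fun a ↦ ?_⟩
  obtain ⟨y, rfl⟩ := freeCover_surjective (R := R) M a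
  have h1 : δ (v (freeCover M y)) = swapCharacter f (freeCover M y) := by
    rw [hv, LinearMap.sub_apply, map_sub, ht]
    exact (congrArg _ (g y).2).trans (sub_zero _)
  exact (DFunLike.congr_fun h1 x).symm

theorem memGPperp_iff_memPerpGI (hdim : ringKrullDim R < ⊤)
    (h : ∀ E : ModuleCat.{u} R, IsGorensteinInjective E → GPPureInjective E)
    (M : ModuleCat.{u} R) : MemGPperp M ↔ MemPerpGI M := by
  refine ⟨fun hM ↦ memPerpGI_of_homAcyclic h (homAcyclic_of_memGPperp hM), fun hM ↦ ?_⟩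
  refine memGPperp_of_homAcyclic (HomAcyclic.of_character (fun N _ _ hN ↦ ?_)
    (homAcyclic_characterModule_of_memPerpGI hdim hM))
  exact homAcyclic_characterModule_of_memPerpGI hdim
    (memPerpGI_of_homAcyclic h (M := ModuleCat.of R (CharacterModule N)) hN)

end GorensteinModules

end VirtuallyGorenstein

/-- Over a Noetherian ring of finite Krull dimension, if the `GP`-pure
injective modules are exactly the Gorenstein injective modules, then `R` is virtually
Gorenstein. -/
theorem stmt19 {R : Type u} [CommRing R] (hNoeth : IsNoetherianRing R)
    (hdim : ringKrullDim R < ⊤)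
    (h : ∀ M : ModuleCat.{u} R, GPPureInjective M ↔ IsGorensteinInjective M) :
    ∀ M : ModuleCat.{u} R, MemGPperp M ↔ MemPerpGI M :=
  VirtuallyGorenstein.memGPperp_iff_memPerpGI hdim fun E ↦ (h E).mpr
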